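/- arXiv:2211.02503 — 2 statements merged into one kernel-verified Lean document; each statement's English description precedes it below -/
import Mathlib

section
/- Let C, C₁, C₂, … be d-dimensional Archimedean copulas with generators ψ, ψ₁, ψ₂, …. If (C_n) converges uniformly to C, then for every ℓ ∈ {1,…,d−1} there exists a set Λ ∈ B([0,1]^ℓ) with μ_{C^{1:ℓ}}(Λ) = 1 such that for every x ∈ Λ there is a dense subset Uˣ of [0,1]^{d−ℓ} with lim_{n→∞} K_n(x,[0,y]) = K_ψ(x,[0,y]) for every y ∈ Uˣ; in particular (C_n) converges ℓ-weakly conditional to C for every ℓ ∈ {1,…,d−1}. -/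
open MeasureTheory ProbabilityTheory Set Filter Topology
open scoped ENNReal

noncomputable section
attribute [local instance] Classical.propDecidable

/-- The lower-orthant box `[0, y] = [0,y₁] × ⋯ × [0,y_k]` (as a lower set in `ℝ^k`;
all measures considered are supported on the unit cube). -/
def lowerBox {k : ℕ} (y : Fin k → ℝ) : Set (Fin k → ℝ) := {t | ∀ i, t i ≤ y i}

/-- The closed unit cube `[0,1]^k`. -/
def unitCube (k : ℕ) : Set (Fin k → ℝ) := {t | ∀ i, t i ∈ Icc (0 : ℝ) 1}

/-- Evaluation of a generator `ψ` at an extended-real argument, with `ψ(∞) = 0`. -/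
def evalPsi (ψ : ℝ → ℝ) (s : ℝ≥0∞) : ℝ := if s = ∞ then 0 else ψ s.toReal

/-- `ψ^{(ℓ)}(s)`, with `ψ^{(ℓ)}` replaced by the left-hand derivative `D⁻ψ^{(d−2)}`
when `ℓ = d − 1`, and extended by `0` at `s = ∞`. -/
def psiD (d l : ℕ) (ψ : ℝ → ℝ) (s : ℝ≥0∞) : ℝ :=
  if s = ∞ then 0
  else if l = d - 1 then derivWithin (iteratedDeriv (d - 2) ψ) (Iio s.toReal) s.toReal
  else iteratedDeriv l ψ s.toReal

/-- `ψ` is a `d`-monotone Archimedean generator, with pseudoinverse `φ`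
(valued in `ℝ≥0∞`; `φ 0 = inf{z : ψ(z) = 0}` which equals `∞` iff the generator is strict). -/
structure IsGenerator (d : ℕ) (ψ : ℝ → ℝ) (φ : ℝ → ℝ≥0∞) : Prop where
  continuousOn : ContinuousOn ψ (Ici 0)
  at_zero : ψ 0 = 1
  tendsto_zero : Tendsto ψ atTop (nhds 0)
  nonneg : ∀ z : ℝ, 0 ≤ z → 0 ≤ ψ z
  antitoneOn : AntitoneOn ψ (Ici 0)
  strict_anti : ∀ z₁ z₂ : ℝ, 0 ≤ z₁ → z₁ < z₂ → 0 < ψ z₂ → ψ z₂ < ψ z₁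
  smooth : ∀ z : ℝ, 0 < z → ContDiffAt ℝ ((d - 2 : ℕ) : ℕ∞) ψ z
  alt_sign : ∀ m : ℕ, m ≤ d - 2 → ∀ z : ℝ, 0 < z → 0 ≤ (-1 : ℝ) ^ m * iteratedDeriv m ψ z
  top_antitone : AntitoneOn (fun z => (-1 : ℝ) ^ (d - 2) * iteratedDeriv (d - 2) ψ z) (Ioi 0)
  top_convex : ConvexOn ℝ (Ioi 0) (fun z => (-1 : ℝ) ^ (d - 2) * iteratedDeriv (d - 2) ψ z)
  phi_finite : ∀ t : ℝ, 0 < t → φ t ≠ ∞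
  phi_one : φ 1 = 0
  phi_antitoneOn : AntitoneOn φ (Ioc 0 1)
  psi_phi : ∀ t : ℝ, 0 < t → t ≤ 1 → evalPsi ψ (φ t) = t
  phi_zero : φ 0 = sInf {s : ℝ≥0∞ | evalPsi ψ s = 0}

/-- The explicit formula for the `ℓ`-Markov kernel of the Archimedean copula generated by
`ψ`, evaluated at the box `[0,y]`.  The first case is `min(x) = 1` or `x ∈ L₀^{1:ℓ}`
(the latter meaning `C^{1:ℓ}(x) = ψ(Σᵢφ(xᵢ)) = 0`); the second case is
`(x,y) ∈ int L₀` (i.e. `Σᵢφ(xᵢ) + Σⱼφ(yⱼ) > φ(0) = inf{z : ψ(z) = 0}`); the third case is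
the ratio `ψ^{(ℓ)}(Σᵢφ(xᵢ) + Σⱼφ(yⱼ)) / ψ^{(ℓ)}(Σᵢφ(xᵢ))`. -/
def archK (d l : ℕ) (ψ : ℝ → ℝ) (φ : ℝ → ℝ≥0∞) (x : Fin l → ℝ) (y : Fin (d - l) → ℝ) : ℝ :=
  if (∀ i, x i = 1) ∨ evalPsi ψ (∑ i, φ (x i)) = 0 then 1
  else if ∃ t : ℝ≥0∞, t < (∑ i, φ (x i)) + ∑ j, φ (y j) ∧ evalPsi ψ t = 0 then 0
  else psiD d l ψ ((∑ i, φ (x i)) + ∑ j, φ (y j)) / psiD d l ψ (∑ i, φ (x i))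

/-- `K` disintegrates `μ` over its first marginal:
`μ(G) = ∫ K(x, G_x) dμ^{1:ℓ}(x)` for every Borel set `G`. -/
def IsDisintegration {α β : Type*} [MeasurableSpace α] [MeasurableSpace β]
    (μ : Measure (α × β)) (K : Kernel α β) : Prop :=
  ∀ G : Set (α × β), MeasurableSet G →
    μ G = ∫⁻ a, K a (Prod.mk a ⁻¹' G) ∂(μ.map Prod.fst)

/-- Weak convergence of a sequence of (probability) measures. -/
def WeakConv {α : Type*} [MeasurableSpace α] [TopologicalSpace α]
    (μn : ℕ → Measure α) (μ : Measure α) : Prop :=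
  ∀ f : BoundedContinuousFunction α ℝ,
    Tendsto (fun n => ∫ a, f a ∂(μn n)) atTop (nhds (∫ a, f a ∂μ))

/-! ### Convex analysis on `(0,∞)` -/

/-- Left derivative. -/
def lDer (f : ℝ → ℝ) (z : ℝ) : ℝ := derivWithin f (Iio z) z

lemma lDer_le_slope {f : ℝ → ℝ} (hf : ConvexOn ℝ (Ioi 0) f) {x c e : ℝ} (hx : 0 < x)
    (hxc : x ≤ c) (hce : c < e) : lDer f x ≤ (f e - f c) / (e - c) := by
  have hc : c ∈ interior (Ioi (0 : ℝ)) := by rw [interior_Ioi]; exact hx.trans_le hxc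
  have hx' : x ∈ interior (Ioi (0 : ℝ)) := by rw [interior_Ioi]; exact hx
  have h1 := hf.monotoneOn_leftDeriv hx' hc hxc
  have h2 := hf.leftDeriv_le_rightDeriv_of_mem_interior hc
  have h3 := hf.rightDeriv_le_slope_of_mem_interior hc (y := e)
    (show e ∈ Ioi (0:ℝ) from (hx.trans_le hxc).trans hce) hce
  rw [slope_def_field] at h3
  exact h1.trans (h2.trans h3)

lemma slope_le_lDer {f : ℝ → ℝ} (hf : ConvexOn ℝ (Ioi 0) f) {x a b : ℝ} (ha : 0 < a)
    (hab : a < b) (hbx : b ≤ x) : (f b - f a) / (b - a) ≤ lDer f x := by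
  have hb : b ∈ interior (Ioi (0 : ℝ)) := by rw [interior_Ioi]; exact ha.trans hab
  have hx' : x ∈ interior (Ioi (0 : ℝ)) := by
    rw [interior_Ioi]; exact (ha.trans hab).trans_le hbx
  have h1 := hf.monotoneOn_leftDeriv hb hx' hbx
  have h3 := hf.slope_le_leftDeriv_of_mem_interior (x := a) (y := b) ha hb hab
  rw [slope_def_field] at h3
  exact h3.trans h1

lemma two_slope_tendsto {g : ℝ → ℝ} {u g' : ℝ} (hg : HasDerivAt g g' u) :
    Tendsto (fun h : ℝ => (g (u + 2 * h) - g (u + h)) / ((u + 2 * h) - (u + h)))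
      (𝓝[≠] 0) (𝓝 g') := by
  have h1 : Tendsto (fun h : ℝ => h⁻¹ • (g (u + h) - g u)) (𝓝[≠] 0) (𝓝 g') :=
    hasDerivAt_iff_tendsto_slope_zero.1 hg
  have hm : Tendsto (fun h : ℝ => 2 * h) (𝓝[≠] 0) (𝓝[≠] 0) := by
    apply tendsto_nhdsWithin_of_tendsto_nhds_of_eventually_within
    · have : Tendsto (fun h : ℝ => 2 * h) (𝓝 0) (𝓝 (2 * 0)) := by
        exact (continuous_const.mul continuous_id).tendsto 0
      rw [mul_zero] at this
      exact this.mono_left nhdsWithin_le_nhds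
    · filter_upwards [self_mem_nhdsWithin] with h hh
      simpa using hh
  have h2 := h1.comp hm
  have h3 := (h2.const_mul 2).sub h1
  have e : 2 * g' - g' = g' := by ring
  rw [e] at h3
  refine h3.congr' ?_
  filter_upwards [self_mem_nhdsWithin] with h hh
  have hh' : h ≠ 0 := hh
  have e1 : (u + 2 * h) - (u + h) = h := by ring
  simp only [Function.comp, smul_eq_mul]
  rw [e1]
  field_simp
  ring

lemma lDer_tendsto {g : ℕ → ℝ → ℝ} {G : ℝ → ℝ} (hg : ∀ n, ConvexOn ℝ (Ioi 0) (g n))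
    (hp : ∀ z, 0 < z → Tendsto (fun n => g n z) atTop (𝓝 (G z)))
    {u : ℝ} (hu : 0 < u) (hd : DifferentiableAt ℝ G u) {un : ℕ → ℝ}
    (hun : Tendsto un atTop (𝓝 u)) :
    Tendsto (fun n => lDer (g n) (un n)) atTop (𝓝 (lDer G u)) := by
  have hlg : lDer G u = deriv G u := by
    exact (hd.hasDerivAt.hasDerivWithinAt).derivWithin (uniqueDiffWithinAt_Iio u)
  rw [hlg]
  have hts := two_slope_tendsto hd.hasDerivAt
  have hps : ∀ a b : ℝ, 0 < a → 0 < b →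
      Tendsto (fun n => (g n b - g n a) / (b - a)) atTop (𝓝 ((G b - G a) / (b - a))) :=
    fun a b ha hb => ((hp b hb).sub (hp a ha)).div_const _
  rw [tendsto_order]
  constructor
  · intro r hr
    have h1 : ∀ᶠ h in 𝓝[<] (0:ℝ), r < (G (u + 2 * h) - G (u + h)) / ((u + 2 * h) - (u + h)) :=
      (hts.mono_left (nhdsWithin_mono _ (fun x hx => ne_of_lt hx))).eventually_const_lt hr
    have h2 : ∀ᶠ h in 𝓝[<] (0:ℝ), -(u/2) < h :=
      nhdsWithin_le_nhds (lt_mem_nhds (by linarith))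
    obtain ⟨h, ⟨h1, h2⟩, h3⟩ := ((h1.and h2).and self_mem_nhdsWithin).exists
    have h3 : h < 0 := h3
    have h1' : r < (G (u + h) - G (u + 2 * h)) / ((u + h) - (u + 2 * h)) := by
      rw [← neg_sub (G (u+2*h)), ← neg_sub (u+2*h), neg_div_neg_eq]; exact h1
    filter_upwards [(hps (u + 2 * h) (u + h) (by linarith) (by linarith)).eventually_const_lt h1',
      hun.eventually_const_lt (show u + h < u by linarith)] with n hn hn2
    exact hn.trans_le (slope_le_lDer (hg n) (by linarith) (by linarith) hn2.le)
  · intro r hr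
    have h1 : ∀ᶠ h in 𝓝[>] (0:ℝ), (G (u + 2 * h) - G (u + h)) / ((u + 2 * h) - (u + h)) < r :=
      (hts.mono_left (nhdsWithin_mono _ (fun x hx => ne_of_gt hx))).eventually_lt_const hr
    obtain ⟨h, h1, h3⟩ := (h1.and self_mem_nhdsWithin).exists
    have h3 : 0 < h := h3
    filter_upwards [(hps (u + h) (u + 2 * h) (by linarith) (by linarith)).eventually_lt_const h1,
      hun.eventually_lt_const (show u < u + h by linarith),
      hun.eventually_const_lt hu] with n hn hn2 hn3
    exact (lDer_le_slope (hg n) hn3 hn2.le (by linarith)).trans_lt hn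

lemma countable_not_diff {f : ℝ → ℝ} (hf : ConvexOn ℝ (Ioi 0) f) :
    {x | 0 < x ∧ ¬ DifferentiableAt ℝ f x}.Countable := by
  have hm : MonotoneOn (lDer f) (Ioi 0) := by
    have := hf.monotoneOn_leftDeriv
    rwa [interior_Ioi] at this
  refine hm.countable_not_continuousWithinAt.mono ?_
  rintro x ⟨hx, hnd⟩
  refine ⟨hx, fun hc => hnd ?_⟩
  have hx' : x ∈ interior (Ioi (0 : ℝ)) := by rw [interior_Ioi]; exact hx
  have hl := hf.hasDerivWithinAt_leftDeriv_of_mem_interior hx'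
  have hr := hf.hasDerivWithinAt_rightDeriv_of_mem_interior hx'
  have hle := hf.leftDeriv_le_rightDeriv_of_mem_interior hx'
  have hge : derivWithin f (Ioi x) x ≤ derivWithin f (Iio x) x := by
    have ht : Tendsto (lDer f) (𝓝[>] x) (𝓝 (lDer f x)) :=
      hc.mono_left (nhdsWithin_mono _ (fun y hy => lt_trans hx hy))
    refine ge_of_tendsto ht ?_
    filter_upwards [self_mem_nhdsWithin] with y hy
    have hy : x < y := hy
    have hy0 : 0 < y := lt_trans hx hy
    have h1 := hf.rightDeriv_le_slope_of_mem_interior hx' (y := y) hy0 hy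
    have h2 := hf.slope_le_leftDeriv_of_mem_interior (x := x) (y := y) hx
      (by rw [interior_Ioi]; exact hy0) hy
    exact h1.trans h2
  have heq := le_antisymm hle hge
  rw [← heq] at hr
  have := hl.union hr
  rw [Iio_union_Ioi] at this
  have h2 : HasDerivWithinAt f (derivWithin f (Iio x) x) univ x := by
    rw [← hasDerivWithinAt_sdiff_singleton]
    rwa [← compl_eq_univ_sdiff]
  exact (hasDerivWithinAt_univ.1 h2).differentiableAt

/-- A chain of completely-monotone-like functions on `(0,∞)`. -/
structure MChain (N : ℕ) (F : ℕ → ℝ → ℝ) : Prop where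
  nonneg : ∀ m ≤ N, ∀ z, 0 < z → 0 ≤ F m z
  anti : ∀ m ≤ N, AntitoneOn (F m) (Ioi 0)
  conv : ∀ m ≤ N, ConvexOn ℝ (Ioi 0) (F m)
  der : ∀ m < N, ∀ z, 0 < z → HasDerivAt (F m) (- F (m+1) z) z
  lim : Tendsto (F 0) atTop (𝓝 0)

lemma MChain.mono {N M : ℕ} {F : ℕ → ℝ → ℝ} (h : MChain N F) (hM : M ≤ N) : MChain M F :=
  ⟨fun m hm => h.nonneg m (hm.trans hM), fun m hm => h.anti m (hm.trans hM),
   fun m hm => h.conv m (hm.trans hM), fun m hm => h.der m (hm.trans_le hM), h.lim⟩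

lemma lDer_of_hasDerivAt {f : ℝ → ℝ} {z f' : ℝ} (h : HasDerivAt f f' z) : lDer f z = f' :=
  h.hasDerivWithinAt.derivWithin (uniqueDiffWithinAt_Iio z)

lemma MChain.limAll {N : ℕ} {F : ℕ → ℝ → ℝ} (h : MChain N F) :
    ∀ m ≤ N, Tendsto (F m) atTop (𝓝 0) := by
  intro m
  induction m with
  | zero => intro _; exact h.lim
  | succ m ih =>
    intro hm
    have ih := ih (by omega)
    have h1 : Tendsto (fun z : ℝ => F m (z + (-1)) - F m z) atTop (𝓝 (0 - 0)) :=
      (ih.comp (tendsto_atTop_add_const_right _ (-1) tendsto_id)).sub ih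
    rw [sub_zero] at h1
    refine tendsto_of_tendsto_of_tendsto_of_le_of_le' tendsto_const_nhds h1 ?_ ?_
    · filter_upwards [eventually_gt_atTop 0] with z hz using h.nonneg _ hm z hz
    · filter_upwards [eventually_gt_atTop 1] with z hz
      have := slope_le_lDer (h.conv m (by omega)) (x := z) (a := z + (-1)) (b := z)
        (by linarith) (by linarith) le_rfl
      rw [lDer_of_hasDerivAt (h.der m (by omega) z (by linarith))] at this
      have e : z - (z + (-1)) = 1 := by ring
      rw [e, div_one] at this
      linarith

lemma MChain.lDer_neg {N : ℕ} {F : ℕ → ℝ → ℝ} (h : MChain N F) {s : ℝ} (hs : 0 < s)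
    (hF : 0 < F 0 s) : ∀ m ≤ N, 0 < F m s ∧ lDer (F m) s < 0 := by
  have key : ∀ m ≤ N, 0 < F m s → lDer (F m) s < 0 := by
    intro m hm hpos
    by_contra hcon
    push Not at hcon
    have h1 : ∀ e, s < e → F m s ≤ F m e := by
      intro e he
      have := lDer_le_slope (h.conv m hm) hs le_rfl he
      have h2 : 0 ≤ (F m e - F m s) / (e - s) := hcon.trans this
      have h3 : 0 < e - s := by linarith
      have := (div_nonneg_iff.1 h2)
      rcases this with h | h
      · linarith [h.1]
      · linarith [h.2]
    have h2 : F m s ≤ 0 := by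
      refine ge_of_tendsto (h.limAll m hm) ?_
      filter_upwards [eventually_gt_atTop s] with e he using h1 e he
    linarith
  intro m
  induction m with
  | zero => intro hm; exact ⟨hF, key 0 hm hF⟩
  | succ m ih =>
    intro hm
    have ih := (ih (by omega)).2
    rw [lDer_of_hasDerivAt (h.der m (by omega) s hs)] at ih
    have : 0 < F (m+1) s := by linarith
    exact ⟨this, key _ hm this⟩

open scoped Pointwise in
lemma lDer_scale {f : ℝ → ℝ} {c : ℝ} (hc : 0 < c) (k : ℝ) (z : ℝ) :
    lDer (fun z => k * f (c * z)) z = k * (c * lDer f (c * z)) := by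
  unfold lDer
  rw [derivWithin_const_mul_field]
  have := derivWithin_comp_mul_left c f (Iio z) z
  rw [this]
  have h2 : c • Iio z = Iio (c * z) := by
    rw [LinearOrderedField.smul_Iio hc]
  rw [h2, smul_eq_mul]

lemma MChain.scale {N : ℕ} {F : ℕ → ℝ → ℝ} (h : MChain N F) {c : ℝ} (hc : 0 < c) :
    MChain N (fun m z => c ^ m * F m (c * z)) := by
  refine ⟨?_, ?_, ?_, ?_, ?_⟩
  · intro m hm z hz
    exact mul_nonneg (pow_nonneg hc.le _) (h.nonneg m hm _ (mul_pos hc hz))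
  · intro m hm a ha b hb hab
    exact mul_le_mul_of_nonneg_left (h.anti m hm (mul_pos hc ha) (mul_pos hc hb)
      (mul_le_mul_of_nonneg_left hab hc.le)) (pow_nonneg hc.le _)
  · intro m hm
    refine ⟨convex_Ioi 0, ?_⟩
    intro x hx y hy a b ha hb hab
    have h1 := (h.conv m hm).2 (mul_pos hc hx) (mul_pos hc hy) ha hb hab
    simp only [smul_eq_mul] at h1 ⊢
    have e : c * (a * x + b * y) = a * (c * x) + b * (c * y) := by ring
    rw [e]
    calc c ^ m * F m (a * (c * x) + b * (c * y)) ≤ c ^ m * (a * F m (c * x) + b * F m (c * y)) :=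
          mul_le_mul_of_nonneg_left h1 (pow_nonneg hc.le _)
      _ = _ := by ring
  · intro m hm z hz
    have h1 := h.der m hm (c * z) (mul_pos hc hz)
    have h2 : HasDerivAt (fun z : ℝ => c * z) c z := by
      simpa using (hasDerivAt_id z).const_mul c
    have h3 := (h1.comp z h2).const_mul (c ^ m)
    refine h3.congr_deriv ?_
    ring
  · have h1 : Tendsto (fun z : ℝ => c * z) atTop atTop := tendsto_id.const_mul_atTop hc
    have h2 := h.lim.comp h1
    simpa [Function.comp_def] using h2

lemma chain_tendsto {N : ℕ} {Fn : ℕ → ℕ → ℝ → ℝ} {F : ℕ → ℝ → ℝ}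
    (hn : ∀ n, MChain N (Fn n)) (h : MChain N F)
    (h0 : ∀ z, 0 < z → Tendsto (fun n => Fn n 0 z) atTop (𝓝 (F 0 z))) :
    ∀ m ≤ N, ∀ z, 0 < z → Tendsto (fun n => Fn n m z) atTop (𝓝 (F m z)) := by
  intro m
  induction m with
  | zero => intro _; exact h0
  | succ m ih =>
    intro hm z hz
    have ih := ih (by omega)
    have h1 := lDer_tendsto (fun n => (hn n).conv m (by omega)) ih hz
      (h.der m (by omega) z hz).differentiableAt (tendsto_const_nhds (x := z))
    rw [lDer_of_hasDerivAt (h.der m (by omega) z hz)] at h1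
    have h2 := h1.neg
    rw [neg_neg] at h2
    refine h2.congr (fun n => ?_)
    rw [lDer_of_hasDerivAt ((hn n).der m (by omega) z hz), neg_neg]

/-! ### Generators -/

/-- Signed derivatives of the generator. -/
def gF (ψ : ℝ → ℝ) (m : ℕ) (z : ℝ) : ℝ := (-1 : ℝ) ^ m * iteratedDeriv m ψ z

section gen
variable {d : ℕ} {ψ : ℝ → ℝ} {φ : ℝ → ℝ≥0∞}

lemma gen_hasDerivAt (h : IsGenerator d ψ φ) {m : ℕ} (hm : m < d - 2) {z : ℝ} (hz : 0 < z) :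
    HasDerivAt (iteratedDeriv m ψ) (iteratedDeriv (m+1) ψ z) z := by
  have h1 : DifferentiableAt ℝ (iteratedDeriv m ψ) z := by
    have h2 : ContDiffWithinAt ℝ ((d - 2 : ℕ) : ℕ∞) ψ univ z := (h.smooth z hz).contDiffWithinAt
    have h3 := h2.differentiableWithinAt_iteratedDerivWithin (m := m) (by exact_mod_cast hm)
      (by simp)
    rw [iteratedDerivWithin_univ] at h3
    exact differentiableWithinAt_univ.1 h3
  rw [iteratedDeriv_succ]
  exact h1.hasDerivAt

lemma gF_hasDerivAt (h : IsGenerator d ψ φ) {m : ℕ} (hm : m < d - 2) {z : ℝ} (hz : 0 < z) :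
    HasDerivAt (gF ψ m) (- gF ψ (m+1) z) z := by
  have h1 := (gen_hasDerivAt h hm hz).const_mul ((-1 : ℝ) ^ m)
  refine h1.congr_deriv ?_
  unfold gF
  rw [pow_succ]; ring

lemma gen_chain (h : IsGenerator d ψ φ) : MChain (d - 2) (gF ψ) := by
  have hder : ∀ m < d - 2, ∀ z, 0 < z → HasDerivAt (gF ψ m) (- gF ψ (m+1) z) z :=
    fun m hm z hz => gF_hasDerivAt h hm hz
  have hanti : ∀ m ≤ d - 2, AntitoneOn (gF ψ m) (Ioi 0) := by
    intro m hm
    rcases hm.lt_or_eq with hm | rfl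
    · refine antitoneOn_of_deriv_nonpos (convex_Ioi 0) ?_ ?_ ?_
      · exact fun z hz => (hder m hm z hz).continuousAt.continuousWithinAt
      · rw [interior_Ioi]
        exact fun z hz => (hder m hm z hz).differentiableAt.differentiableWithinAt
      · rw [interior_Ioi]
        intro z hz
        rw [(hder m hm z hz).deriv]
        exact neg_nonpos.2 (h.alt_sign (m+1) hm z hz)
    · exact h.top_antitone
  refine ⟨fun m hm z hz => h.alt_sign m hm z hz, hanti, ?_, hder, ?_⟩
  · intro m hm
    rcases hm.lt_or_eq with hm | rfl
    · refine MonotoneOn.convexOn_of_deriv (convex_Ioi 0) ?_ ?_ ?_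
      · exact fun z hz => (hder m hm z hz).continuousAt.continuousWithinAt
      · rw [interior_Ioi]
        exact fun z hz => (hder m hm z hz).differentiableAt.differentiableWithinAt
      · rw [interior_Ioi]
        intro a ha b hb hab
        rw [(hder m hm a ha).deriv, (hder m hm b hb).deriv]
        exact neg_le_neg (hanti (m+1) hm ha hb hab)
    · exact h.top_convex
  · have : gF ψ 0 = ψ := by
      funext z; simp [gF]
    rw [this]; exact h.tendsto_zero

lemma gF_zero (ψ : ℝ → ℝ) : gF ψ 0 = ψ := by
  funext z; simp [gF]

lemma psiD_eq (h : IsGenerator d ψ φ) {l : ℕ} (hl : 1 ≤ l) (hld : l ≤ d - 1) {s : ℝ≥0∞}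
    (hs : s ≠ ∞) (hs0 : 0 < s.toReal) :
    psiD d l ψ s = (-1 : ℝ) ^ (l - 1) * lDer (gF ψ (l-1)) s.toReal := by
  have e : lDer (gF ψ (l-1)) s.toReal
      = (-1 : ℝ) ^ (l - 1) * derivWithin (iteratedDeriv (l-1) ψ) (Iio s.toReal) s.toReal := by
    unfold lDer gF
    rw [derivWithin_const_mul_field]
  rw [e, ← mul_assoc, ← mul_pow]
  simp only [mul_neg, mul_one, neg_neg, one_pow, one_mul]
  unfold psiD
  rw [if_neg hs]
  split_ifs with h1
  · have : d - 2 = l - 1 := by omega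
    rw [this]
  · obtain ⟨m, rfl⟩ : ∃ m, l = m + 1 := ⟨l - 1, by omega⟩
    have h2 := gen_hasDerivAt h (m := m) (by omega) hs0
    simp only [Nat.add_sub_cancel]
    exact (h2.hasDerivWithinAt.derivWithin (uniqueDiffWithinAt_Iio _)).symm

lemma gen_psi_p (h : IsGenerator d ψ φ) {t : ℝ} (h0 : 0 < t) (h1 : t ≤ 1) :
    ψ (φ t).toReal = t := by
  have := h.psi_phi t h0 h1
  unfold evalPsi at this
  rwa [if_neg (h.phi_finite t h0)] at this

lemma gen_le_one (h : IsGenerator d ψ φ) {z : ℝ} (hz : 0 ≤ z) : ψ z ≤ 1 := by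
  rw [← h.at_zero]
  exact h.antitoneOn (mem_Ici.2 le_rfl) hz hz

lemma gen_le_iff (h : IsGenerator d ψ φ) {t z : ℝ} (h0 : 0 < t) (h1 : t ≤ 1) (hz : 0 ≤ z) :
    t ≤ ψ z ↔ z ≤ (φ t).toReal := by
  have hp := gen_psi_p h h0 h1
  constructor
  · intro h2
    by_contra h3
    push Not at h3
    have := h.strict_anti _ _ ENNReal.toReal_nonneg h3 (h0.trans_le h2)
    linarith
  · intro h2
    have := h.antitoneOn (mem_Ici.2 hz) (mem_Ici.2 ENNReal.toReal_nonneg) h2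
    linarith

lemma gen_lt_iff (h : IsGenerator d ψ φ) {t z : ℝ} (h0 : 0 < t) (h1 : t ≤ 1) (hz : 0 ≤ z) :
    ψ z < t ↔ (φ t).toReal < z := by
  have := gen_le_iff h h0 h1 hz
  rw [← not_le, this, not_le]

lemma gen_p_psi (h : IsGenerator d ψ φ) {z : ℝ} (hz : 0 ≤ z) (hp : 0 < ψ z) :
    (φ (ψ z)).toReal = z := by
  have h1 := gen_le_one h hz
  have h2 := gen_psi_p h hp h1
  rcases lt_trichotomy (φ (ψ z)).toReal z with h3 | h3 | h3
  · have := h.strict_anti _ _ ENNReal.toReal_nonneg h3 hp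
    linarith
  · exact h3
  · have := h.strict_anti _ _ hz h3 (by rw [h2]; exact hp)
    linarith

lemma gen_lt_psi_iff (h : IsGenerator d ψ φ) {t z : ℝ} (h0 : 0 < t) (h1 : t ≤ 1) (hz : 0 ≤ z) :
    t < ψ z ↔ z < (φ t).toReal := by
  constructor
  · intro h2
    rcases ((gen_le_iff h h0 h1 hz).1 h2.le).lt_or_eq with h3 | h3
    · exact h3
    · rw [h3, gen_psi_p h h0 h1] at h2
      exact absurd h2 (lt_irrefl _)
  · intro h2
    rcases ((gen_le_iff h h0 h1 hz).2 h2.le).lt_or_eq with h3 | h3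
    · exact h3
    · have := gen_p_psi h hz (by rw [← h3]; exact h0)
      rw [← h3] at this
      linarith

lemma gen_p_pos (h : IsGenerator d ψ φ) {t : ℝ} (h0 : 0 < t) (h1 : t < 1) :
    0 < (φ t).toReal := by
  rw [← gen_lt_psi_iff h h0 h1.le le_rfl, h.at_zero]
  exact h1

lemma gen_p_lt (h : IsGenerator d ψ φ) {a b : ℝ} (a0 : 0 < a) (b0 : 0 < b) (a1 : a ≤ 1)
    (b1 : b ≤ 1) : (φ a).toReal < (φ b).toReal ↔ b < a := by
  rw [← gen_lt_psi_iff h b0 b1 ENNReal.toReal_nonneg, gen_psi_p h a0 a1]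

lemma gen_sum_ne_top (h : IsGenerator d ψ φ) {k : ℕ} {y : Fin k → ℝ} (hy : ∀ j, 0 < y j) :
    ∑ j, φ (y j) ≠ ∞ :=
  ENNReal.sum_ne_top.2 (fun j _ => h.phi_finite _ (hy j))

lemma gen_sum_toReal (h : IsGenerator d ψ φ) {k : ℕ} {y : Fin k → ℝ} (hy : ∀ j, 0 < y j) :
    (∑ j, φ (y j)).toReal = ∑ j, (φ (y j)).toReal :=
  ENNReal.toReal_sum (fun j _ => h.phi_finite _ (hy j))

lemma evalPsi_of_ne {s : ℝ≥0∞} (hs : s ≠ ∞) : evalPsi ψ s = ψ s.toReal := by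
  unfold evalPsi; rw [if_neg hs]

lemma gen_evalPsi_sum (h : IsGenerator d ψ φ) {k : ℕ} {y : Fin k → ℝ} (hy : ∀ j, 0 < y j) :
    evalPsi ψ (∑ j, φ (y j)) = ψ (∑ j, (φ (y j)).toReal) := by
  rw [evalPsi_of_ne (gen_sum_ne_top h hy), gen_sum_toReal h hy]

lemma gen_evalPsi_phi_zero (h : IsGenerator d ψ φ) {s : ℝ≥0∞} (hs : φ 0 ≤ s) :
    evalPsi ψ s = 0 := by
  unfold evalPsi
  split_ifs with h1
  · rfl
  · have h0 : φ 0 ≠ ∞ := fun h2 => h1 (top_le_iff.1 (h2 ▸ hs))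
    -- the zero set accumulates at or below `s`
    have key : ∀ ε : ℝ, 0 < ε → ψ (s.toReal + ε) = 0 := by
      intro ε hε
      have : φ 0 < s + ENNReal.ofReal ε :=
        lt_of_le_of_lt hs (ENNReal.lt_add_right h1 (by simpa using hε))
      rw [h.phi_zero, sInf_lt_iff] at this
      obtain ⟨t, ht, hts⟩ := this
      have htt : t ≠ ∞ := hts.ne_top
      simp only [mem_ofPred_eq, evalPsi_of_ne htt] at ht
      have h3 : t.toReal ≤ s.toReal + ε := by
        have := ENNReal.toReal_mono (by simp [h1]) hts.le
        rwa [ENNReal.toReal_add h1 (by simp), ENNReal.toReal_ofReal hε.le] at this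
      have h4 := h.antitoneOn (mem_Ici.2 ENNReal.toReal_nonneg)
        (mem_Ici.2 (add_nonneg ENNReal.toReal_nonneg hε.le)) h3
      rw [ht] at h4
      exact le_antisymm h4 (h.nonneg _ (add_nonneg ENNReal.toReal_nonneg hε.le))
    have hc : Tendsto ψ (𝓝[>] s.toReal) (𝓝 (ψ s.toReal)) :=
      (h.continuousOn s.toReal (mem_Ici.2 ENNReal.toReal_nonneg)).mono_left
        (nhdsWithin_mono _ (fun y hy => mem_Ici.2 (ENNReal.toReal_nonneg.trans (le_of_lt hy))))
    have h0' : Tendsto ψ (𝓝[>] s.toReal) (𝓝 0) := by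
      refine tendsto_const_nhds.congr' ?_
      filter_upwards [self_mem_nhdsWithin] with y hy
      have := key (y - s.toReal) (sub_pos.2 hy)
      rw [add_sub_cancel] at this
      exact this.symm
    exact tendsto_nhds_unique hc h0'

lemma archK_eq (h : IsGenerator d ψ φ) {l : ℕ} (hl : 1 ≤ l) (hld : l ≤ d - 1)
    {x : Fin l → ℝ} {y : Fin (d - l) → ℝ} (hx0 : ∀ i, 0 < x i) (hx1 : ∀ i, x i < 1)
    (hy0 : ∀ j, 0 < y j) (hpos : ψ (∑ i, (φ (x i)).toReal) ≠ 0) :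
    archK d l ψ φ x y =
      lDer (gF ψ (l-1)) (∑ i, (φ (x i)).toReal + ∑ j, (φ (y j)).toReal) /
      lDer (gF ψ (l-1)) (∑ i, (φ (x i)).toReal) := by
  have hxt := gen_sum_ne_top h hx0
  have hyt := gen_sum_ne_top h hy0
  have hs0 : 0 < (∑ i, φ (x i)).toReal := by
    rw [gen_sum_toReal h hx0]
    exact Finset.sum_pos (fun i _ => gen_p_pos h (hx0 i) (hx1 i)) ⟨⟨0, hl⟩, Finset.mem_univ _⟩
  have hut : (∑ i, φ (x i)) + ∑ j, φ (y j) ≠ ∞ := ENNReal.add_ne_top.2 ⟨hxt, hyt⟩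
  have hue : ((∑ i, φ (x i)) + ∑ j, φ (y j)).toReal
      = ∑ i, (φ (x i)).toReal + ∑ j, (φ (y j)).toReal := by
    rw [ENNReal.toReal_add hxt hyt, gen_sum_toReal h hx0, gen_sum_toReal h hy0]
  have hu0 : 0 < ((∑ i, φ (x i)) + ∑ j, φ (y j)).toReal := by
    rw [ENNReal.toReal_add hxt hyt]
    exact add_pos_of_pos_of_nonneg hs0 ENNReal.toReal_nonneg
  unfold archK
  rw [if_neg]
  swap
  · rintro (h1 | h1)
    · exact (hx1 ⟨0, hl⟩).ne (h1 _)
    · rw [gen_evalPsi_sum h hx0] at h1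
      exact hpos h1
  split_ifs with h2
  · obtain ⟨t, htu, ht⟩ := h2
    have htt : t ≠ ∞ := htu.ne_top
    rw [evalPsi_of_ne htt] at ht
    have htr := (ENNReal.toReal_lt_toReal htt hut).2 htu
    have hz : ∀ z, t.toReal < z → gF ψ (l-1) z = 0 := by
      intro z hz
      unfold gF
      have : ψ =ᶠ[𝓝 z] (fun _ => (0:ℝ)) := by
        filter_upwards [lt_mem_nhds hz] with w hw
        have hw0 : 0 ≤ w := ENNReal.toReal_nonneg.trans hw.le
        have := h.antitoneOn (mem_Ici.2 ENNReal.toReal_nonneg) (mem_Ici.2 hw0) hw.le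
        rw [ht] at this
        exact le_antisymm this (h.nonneg w hw0)
      rw [this.iteratedDeriv_eq]
      simp
    have : lDer (gF ψ (l-1)) ((∑ i, φ (x i)) + ∑ j, φ (y j)).toReal = 0 := by
      apply lDer_of_hasDerivAt
      refine (hasDerivAt_const _ (0:ℝ)).congr_of_eventuallyEq ?_
      filter_upwards [lt_mem_nhds htr] with w hw using hz w hw
    rw [← hue, this, zero_div]
  · rw [psiD_eq h hl hld hut hu0, psiD_eq h hl hld hxt hs0, hue, gen_sum_toReal h hx0]
    rw [mul_div_mul_left]
    exact pow_ne_zero _ (by norm_num)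

end gen

/-! ### Convergence of generators -/

section genconv
variable {d : ℕ} {ψ : ℝ → ℝ} {φ : ℝ → ℝ≥0∞} {ψn : ℕ → ℝ → ℝ} {φn : ℕ → ℝ → ℝ≥0∞}

lemma pair_sum {e : ℕ} (h : IsGenerator (e+2) ψ φ) {a b : ℝ} (a0 : 0 < a) (b0 : 0 < b) :
    evalPsi ψ (∑ i, φ ((Fin.cons a (Fin.cons b (fun _ => 1)) : Fin (e+2) → ℝ) i))
      = ψ ((φ a).toReal + (φ b).toReal) := by
  rw [Fin.sum_univ_succ, Fin.sum_univ_succ]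
  simp only [Fin.cons_zero, Fin.cons_succ, h.phi_one, Finset.sum_const_zero, add_zero]
  rw [evalPsi_of_ne (ENNReal.add_ne_top.2 ⟨h.phi_finite a a0, h.phi_finite b b0⟩),
    ENNReal.toReal_add (h.phi_finite a a0) (h.phi_finite b b0)]

lemma pair_conv (hd : 2 ≤ d) (hgen : IsGenerator d ψ φ) (hgenn : ∀ n, IsGenerator d (ψn n) (φn n))
    (hconv : TendstoUniformlyOn
      (fun n (x : Fin d → ℝ) => evalPsi (ψn n) (∑ i, φn n (x i)))
      (fun x : Fin d → ℝ => evalPsi ψ (∑ i, φ (x i))) atTop (unitCube d))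
    {a b : ℝ} (a0 : 0 < a) (a1 : a ≤ 1) (b0 : 0 < b) (b1 : b ≤ 1) :
    Tendsto (fun n => ψn n ((φn n a).toReal + (φn n b).toReal)) atTop
      (𝓝 (ψ ((φ a).toReal + (φ b).toReal))) := by
  obtain ⟨e, rfl⟩ : ∃ e, d = e + 2 := ⟨d - 2, by omega⟩
  have hx : (Fin.cons a (Fin.cons b (fun _ => 1)) : Fin (e+2) → ℝ) ∈ unitCube (e+2) := by
    intro i
    refine Fin.cases ?_ (fun i => ?_) i
    · exact ⟨a0.le, a1⟩
    · refine Fin.cases ?_ (fun i => ?_) i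
      · exact ⟨b0.le, b1⟩
      · simp
  have := hconv.tendsto_at hx
  simp only [pair_sum hgen a0 b0, pair_sum (hgenn _) a0 b0] at this
  exact this

/-- lower comparison with multiples -/
lemma mult_lt (hgen : IsGenerator d ψ φ) (hgenn : ∀ n, IsGenerator d (ψn n) (φn n))
    (hC : ∀ a b : ℝ, 0 < a → a ≤ 1 → 0 < b → b ≤ 1 →
      Tendsto (fun n => ψn n ((φn n a).toReal + (φn n b).toReal)) atTop
      (𝓝 (ψ ((φ a).toReal + (φ b).toReal)))) {c : ℝ} (c0 : 0 < c) (c1 : c < 1) :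
    ∀ k : ℕ, ∀ w, 0 < w → w ≤ 1 → k * (φ c).toReal < (φ w).toReal →
      ∀ᶠ n in atTop, k * (φn n c).toReal < (φn n w).toReal := by
  intro k
  induction k with
  | zero =>
    intro w w0 w1 hw
    simp only [Nat.cast_zero, zero_mul] at hw ⊢
    have hw1 : w < 1 := by
      rw [← gen_lt_psi_iff hgen w0 w1 le_rfl, hgen.at_zero] at hw
      exact hw
    exact Eventually.of_forall (fun n => gen_p_pos (hgenn n) w0 hw1)
  | succ k ih =>
    intro w w0 w1 hw
    push_cast at hw ⊢
    have hcp := gen_p_pos hgen c0 c1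
    have hk0 : 0 ≤ (k:ℝ) * (φ c).toReal := by positivity
    obtain ⟨z, hz1, hz2⟩ := exists_between
      (show (k:ℝ) * (φ c).toReal < (φ w).toReal - (φ c).toReal by linarith)
    have hz0 : 0 ≤ z := hk0.trans hz1.le
    have hzw : w < ψ z := (gen_lt_psi_iff hgen w0 w1 hz0).2 (by linarith)
    have hr0 : 0 < ψ z := w0.trans hzw
    have hr1 := gen_le_one hgen hz0
    have hpr := gen_p_psi hgen hz0 hr0
    have h1 := ih (ψ z) hr0 hr1 (by rw [hpr]; exact hz1)
    have h2 := hC (ψ z) c hr0 hr1 c0 c1.le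
    have h3 : w < ψ ((φ (ψ z)).toReal + (φ c).toReal) := by
      rw [gen_lt_psi_iff hgen w0 w1 (add_nonneg ENNReal.toReal_nonneg ENNReal.toReal_nonneg), hpr]
      linarith
    filter_upwards [h1, h2.eventually_const_lt h3] with n hn1 hn2
    rw [gen_lt_psi_iff (hgenn n) w0 w1
      (add_nonneg ENNReal.toReal_nonneg ENNReal.toReal_nonneg)] at hn2
    linarith

/-- upper comparison with multiples -/
lemma lt_mult (hgen : IsGenerator d ψ φ) (hgenn : ∀ n, IsGenerator d (ψn n) (φn n))
    (hC : ∀ a b : ℝ, 0 < a → a ≤ 1 → 0 < b → b ≤ 1 →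
      Tendsto (fun n => ψn n ((φn n a).toReal + (φn n b).toReal)) atTop
      (𝓝 (ψ ((φ a).toReal + (φ b).toReal)))) {c : ℝ} (c0 : 0 < c) (c1 : c < 1) :
    ∀ k : ℕ, ∀ w, 0 < w → w ≤ 1 → (φ w).toReal < k * (φ c).toReal →
      ∀ᶠ n in atTop, (φn n w).toReal < k * (φn n c).toReal := by
  intro k
  induction k with
  | zero =>
    intro w w0 w1 hw
    simp only [Nat.cast_zero, zero_mul] at hw
    exact absurd hw (not_lt.2 ENNReal.toReal_nonneg)
  | succ k ih =>
    intro w w0 w1 hw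
    push_cast at hw ⊢
    have hcp := gen_p_pos hgen c0 c1
    have hk0 : 0 ≤ (k:ℝ) * (φ c).toReal := by positivity
    by_cases hwc : (φ w).toReal < (φ c).toReal
    · rw [gen_p_lt hgen w0 c0 w1 c1.le] at hwc
      refine Eventually.of_forall (fun n => ?_)
      have h1 := (gen_p_lt (hgenn n) w0 c0 w1 c1.le).2 hwc
      have h2 : 0 ≤ (k:ℝ) * (φn n c).toReal :=
        mul_nonneg (Nat.cast_nonneg _) ENNReal.toReal_nonneg
      linarith
    · push Not at hwc
      obtain ⟨z, hz1, hz2⟩ := exists_between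
        (show (φ w).toReal - (φ c).toReal < min ((k:ℝ) * (φ c).toReal) (φ w).toReal by
          rw [lt_min_iff]; constructor <;> linarith)
      rw [lt_min_iff] at hz2
      have hz0 : 0 ≤ z := by linarith
      have hzw : w < ψ z := (gen_lt_psi_iff hgen w0 w1 hz0).2 hz2.2
      have hr0 : 0 < ψ z := w0.trans hzw
      have hr1 := gen_le_one hgen hz0
      have hpr := gen_p_psi hgen hz0 hr0
      have h1 := ih (ψ z) hr0 hr1 (by rw [hpr]; exact hz2.1)
      have h2 := hC (ψ z) c hr0 hr1 c0 c1.le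
      have h3 : ψ ((φ (ψ z)).toReal + (φ c).toReal) < w := by
        rw [gen_lt_iff hgen w0 w1 (add_nonneg ENNReal.toReal_nonneg ENNReal.toReal_nonneg), hpr]
        linarith
      filter_upwards [h1, h2.eventually_lt_const h3] with n hn1 hn2
      rw [gen_lt_iff (hgenn n) w0 w1
        (add_nonneg ENNReal.toReal_nonneg ENNReal.toReal_nonneg)] at hn2
      linarith

lemma ratio_lt (hgen : IsGenerator d ψ φ) (hgenn : ∀ n, IsGenerator d (ψn n) (φn n))
    (hC : ∀ a b : ℝ, 0 < a → a ≤ 1 → 0 < b → b ≤ 1 →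
      Tendsto (fun n => ψn n ((φn n a).toReal + (φn n b).toReal)) atTop
      (𝓝 (ψ ((φ a).toReal + (φ b).toReal)))) {a b : ℝ} (a0 : 0 < a) (a1 : a < 1)
    (b0 : 0 < b) (b1 : b < 1) {x : ℝ} (hx : 0 < x) (hlt : x * (φ b).toReal < (φ a).toReal) :
    ∀ᶠ n in atTop, x * (φn n b).toReal < (φn n a).toReal := by
  set A := (φ a).toReal with hA
  set B := (φ b).toReal with hB
  have hA0 : 0 < A := gen_p_pos hgen a0 a1
  have hB0 : 0 < B := gen_p_pos hgen b0 b1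
  have hρ : 0 < A / B - x := by
    rw [sub_pos, lt_div_iff₀ hB0]; exact hlt
  obtain ⟨M, hM⟩ := exists_nat_gt (max 1 ((x + 1) / (A / B - x)))
  rw [max_lt_iff] at hM
  have hM1 : (1:ℝ) < M := hM.1
  have hM2 : x + 1 < M * (A / B - x) := (div_lt_iff₀ hρ).1 hM.2
  have hM0 : (0:ℝ) < M := by linarith
  set k := ⌈x * (M + 1)⌉₊ with hk
  have hk1 : x * (M + 1) ≤ k := Nat.le_ceil _
  have hk2 : (k:ℝ) < x * (M + 1) + 1 := Nat.ceil_lt_add_one (by positivity)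
  have hε0 : 0 < B / M := by positivity
  have hεB : B / M ≤ B := div_le_self hB0.le hM1.le
  have hbpos : b ≤ ψ (B / M) := (gen_le_iff hgen b0 b1.le hε0.le).2 hεB
  have hc0 : 0 < ψ (B / M) := b0.trans_le hbpos
  have hpc := gen_p_psi hgen hε0.le hc0
  have hc1 : ψ (B / M) < 1 := by
    have := hgen.strict_anti 0 (B / M) le_rfl hε0 hc0
    rwa [hgen.at_zero] at this
  have h1 := mult_lt hgen hgenn hC hc0 hc1 k a a0 a1.le (by
    rw [hpc, ← hA]
    have : (k:ℝ) < M * (A / B) := by nlinarith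
    calc (k:ℝ) * (B / M) < M * (A / B) * (B / M) := mul_lt_mul_of_pos_right this hε0
      _ = A := by field_simp)
  have h2 := lt_mult hgen hgenn hC hc0 hc1 (M+1) b b0 b1.le (by
    rw [hpc, ← hB]
    push_cast
    have : ((M:ℝ) + 1) * (B / M) = B + B / M := by field_simp
    linarith)
  filter_upwards [h1, h2] with n hn1 hn2
  push_cast at hn2
  have hq : 0 ≤ (φn n (ψ (B / M))).toReal := ENNReal.toReal_nonneg
  calc x * (φn n b).toReal ≤ x * ((M + 1) * (φn n (ψ (B / M))).toReal) :=
        mul_le_mul_of_nonneg_left hn2.le hx.le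
    _ = x * (M + 1) * (φn n (ψ (B / M))).toReal := by ring
    _ ≤ k * (φn n (ψ (B / M))).toReal := mul_le_mul_of_nonneg_right hk1 hq
    _ < _ := hn1

lemma ratio_tendsto (hgen : IsGenerator d ψ φ) (hgenn : ∀ n, IsGenerator d (ψn n) (φn n))
    (hC : ∀ a b : ℝ, 0 < a → a ≤ 1 → 0 < b → b ≤ 1 →
      Tendsto (fun n => ψn n ((φn n a).toReal + (φn n b).toReal)) atTop
      (𝓝 (ψ ((φ a).toReal + (φ b).toReal)))) {a b : ℝ} (a0 : 0 < a) (a1 : a < 1)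
    (b0 : 0 < b) (b1 : b < 1) :
    Tendsto (fun n => (φn n a).toReal / (φn n b).toReal) atTop
      (𝓝 ((φ a).toReal / (φ b).toReal)) := by
  have hA0 : 0 < (φ a).toReal := gen_p_pos hgen a0 a1
  have hB0 : 0 < (φ b).toReal := gen_p_pos hgen b0 b1
  rw [tendsto_order]
  constructor
  · intro r hr
    by_cases hr0 : 0 < r
    · have := ratio_lt hgen hgenn hC a0 a1 b0 b1 hr0 ((lt_div_iff₀ hB0).1 hr)
      filter_upwards [this] with n hn
      rw [lt_div_iff₀ (gen_p_pos (hgenn n) b0 b1)]; exact hn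
    · refine Eventually.of_forall (fun n => ?_)
      exact (not_lt.1 hr0).trans_lt
        (div_pos (gen_p_pos (hgenn n) a0 a1) (gen_p_pos (hgenn n) b0 b1))
  · intro r hr
    have hr0 : 0 < r := (div_pos hA0 hB0).trans hr
    have := ratio_lt hgen hgenn hC b0 b1 a0 a1 (inv_pos.2 hr0) (by
      rw [inv_mul_lt_iff₀ hr0]; exact (div_lt_iff₀ hB0).1 hr)
    filter_upwards [this] with n hn
    rw [div_lt_iff₀ (gen_p_pos (hgenn n) b0 b1)]
    exact (inv_mul_lt_iff₀ hr0).1 hn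

/-- There are scalings `c n` making the generators converge. -/
lemma exists_scaling (hd : 2 ≤ d) (hgen : IsGenerator d ψ φ)
    (hgenn : ∀ n, IsGenerator d (ψn n) (φn n))
    (hconv : TendstoUniformlyOn
      (fun n (x : Fin d → ℝ) => evalPsi (ψn n) (∑ i, φn n (x i)))
      (fun x : Fin d → ℝ => evalPsi ψ (∑ i, φ (x i))) atTop (unitCube d)) :
    ∃ c : ℕ → ℝ, (∀ n, 0 < c n) ∧
      (∀ a, 0 < a → a ≤ 1 → Tendsto (fun n => (φn n a).toReal / c n) atTop (𝓝 (φ a).toReal)) ∧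
      (∀ z, 0 < z → Tendsto (fun n => ψn n (c n * z)) atTop (𝓝 (ψ z))) := by
  have hC : ∀ a b : ℝ, 0 < a → a ≤ 1 → 0 < b → b ≤ 1 →
      Tendsto (fun n => ψn n ((φn n a).toReal + (φn n b).toReal)) atTop
      (𝓝 (ψ ((φ a).toReal + (φ b).toReal))) :=
    fun a b a0 a1 b0 b1 => pair_conv hd hgen hgenn hconv a0 a1 b0 b1
  have hh0 : (0:ℝ) < 1/2 := by norm_num
  have hh1 : (1/2:ℝ) < 1 := by norm_num
  have hP0 := gen_p_pos hgen hh0 hh1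
  have hc : ∀ n, 0 < (φn n (1/2)).toReal / (φ (1/2)).toReal :=
    fun n => div_pos (gen_p_pos (hgenn n) hh0 hh1) hP0
  have hφ : ∀ a, 0 < a → a ≤ 1 →
      Tendsto (fun n => (φn n a).toReal / ((φn n (1/2)).toReal / (φ (1/2)).toReal)) atTop
        (𝓝 (φ a).toReal) := by
    intro a a0 a1
    rcases a1.lt_or_eq with a1 | rfl
    · have h1 := (ratio_tendsto hgen hgenn hC a0 a1 hh0 hh1).mul_const (φ (1/2)).toReal
      rw [div_mul_cancel₀ _ hP0.ne'] at h1
      refine h1.congr (fun n => ?_)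
      rw [div_div_eq_mul_div, div_mul_eq_mul_div]
    · simp [hgen.phi_one, (hgenn _).phi_one]
  refine ⟨fun n => (φn n (1/2)).toReal / (φ (1/2)).toReal, hc, hφ, ?_⟩
  intro z hz
  have hlt1 : ψ z < 1 := by
    rcases (hgen.nonneg z hz.le).lt_or_eq with h | h
    · have := hgen.strict_anti 0 z le_rfl hz h
      rwa [hgen.at_zero] at this
    · rw [← h]; exact one_pos
  rw [tendsto_order]
  constructor
  · intro r hr
    by_cases hr0 : 0 < r
    · have hz' := (gen_lt_psi_iff hgen hr0 (hr.trans hlt1).le hz.le).1 hr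
      filter_upwards [(hφ r hr0 (hr.trans hlt1).le).eventually_const_lt hz'] with n hn
      rw [lt_div_iff₀ (hc n)] at hn
      rw [gen_lt_psi_iff (hgenn n) hr0 (hr.trans hlt1).le (mul_pos (hc n) hz).le]
      linarith
    · push Not at hr0
      have hr' : r < 0 ∨ r = 0 := hr0.lt_or_eq
      rcases hr' with hr' | rfl
      · exact Eventually.of_forall
          (fun n => hr'.trans_le ((hgenn n).nonneg _ (mul_pos (hc n) hz).le))
      · obtain ⟨r', hr1, hr2⟩ := exists_between hr
        have hz' := (gen_lt_psi_iff hgen hr1 (hr2.trans hlt1).le hz.le).1 hr2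
        filter_upwards [(hφ r' hr1 (hr2.trans hlt1).le).eventually_const_lt hz'] with n hn
        rw [lt_div_iff₀ (hc n)] at hn
        refine hr1.trans ?_
        rw [gen_lt_psi_iff (hgenn n) hr1 (hr2.trans hlt1).le (mul_pos (hc n) hz).le]
        linarith
  · intro r hr
    obtain ⟨r', hr1, hr2⟩ := exists_between (lt_min hr hlt1)
    rw [lt_min_iff] at hr2
    have hr0 : 0 < r' := (hgen.nonneg z hz.le).trans_lt hr1
    have hz' := (gen_lt_iff hgen hr0 hr2.2.le hz.le).1 hr1
    filter_upwards [(hφ r' hr0 hr2.2.le).eventually_lt_const hz'] with n hn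
    rw [div_lt_iff₀ (hc n)] at hn
    refine lt_trans ?_ hr2.1
    rw [gen_lt_iff (hgenn n) hr0 hr2.2.le (mul_pos (hc n) hz).le]
    linarith

end genconv

/-! ### Convergence of the explicit kernels -/

section kernelconv
variable {d : ℕ} {ψ : ℝ → ℝ} {φ : ℝ → ℝ≥0∞} {ψn : ℕ → ℝ → ℝ} {φn : ℕ → ℝ → ℝ≥0∞}

lemma archK_tendsto (hd : 2 ≤ d) (hgen : IsGenerator d ψ φ)
    (hgenn : ∀ n, IsGenerator d (ψn n) (φn n))
    (hconv : TendstoUniformlyOn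
      (fun n (x : Fin d → ℝ) => evalPsi (ψn n) (∑ i, φn n (x i)))
      (fun x : Fin d → ℝ => evalPsi ψ (∑ i, φ (x i))) atTop (unitCube d))
    {l : ℕ} (hl : 1 ≤ l) (hld : l ≤ d - 1)
    {x : Fin l → ℝ} {y : Fin (d - l) → ℝ} (hx0 : ∀ i, 0 < x i) (hx1 : ∀ i, x i < 1)
    (hy0 : ∀ j, 0 < y j) (hy1 : ∀ j, y j ≤ 1) (hpos : ψ (∑ i, (φ (x i)).toReal) ≠ 0)
    (hs : DifferentiableAt ℝ (gF ψ (l-1)) (∑ i, (φ (x i)).toReal))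
    (hu : DifferentiableAt ℝ (gF ψ (l-1)) (∑ i, (φ (x i)).toReal + ∑ j, (φ (y j)).toReal)) :
    Tendsto (fun n => archK d l (ψn n) (φn n) x y) atTop (𝓝 (archK d l ψ φ x y)) := by
  obtain ⟨c, hc, hφ, hψ⟩ := exists_scaling hd hgen hgenn hconv
  have hs0 : 0 < ∑ i, (φ (x i)).toReal :=
    Finset.sum_pos (fun i _ => gen_p_pos hgen (hx0 i) (hx1 i)) ⟨⟨0, hl⟩, Finset.mem_univ _⟩
  have hy00 : 0 ≤ ∑ j, (φ (y j)).toReal := Finset.sum_nonneg (fun _ _ => ENNReal.toReal_nonneg)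
  have hψs : 0 < ψ (∑ i, (φ (x i)).toReal) :=
    lt_of_le_of_ne (hgen.nonneg _ hs0.le) (Ne.symm hpos)
  have hsn : Tendsto (fun n => (∑ i, (φn n (x i)).toReal) / c n) atTop
      (𝓝 (∑ i, (φ (x i)).toReal)) := by
    simp only [Finset.sum_div]
    exact tendsto_finsetSum _ (fun i _ => hφ (x i) (hx0 i) (hx1 i).le)
  have hyn : Tendsto (fun n => (∑ j, (φn n (y j)).toReal) / c n) atTop
      (𝓝 (∑ j, (φ (y j)).toReal)) := by
    simp only [Finset.sum_div]
    exact tendsto_finsetSum _ (fun i _ => hφ (y i) (hy0 i) (hy1 i))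
  have hun : Tendsto (fun n => (∑ i, (φn n (x i)).toReal + ∑ j, (φn n (y j)).toReal) / c n) atTop
      (𝓝 (∑ i, (φ (x i)).toReal + ∑ j, (φ (y j)).toReal)) := by
    simp only [add_div]
    exact hsn.add hyn
  -- eventual positivity
  have hev : ∀ᶠ n in atTop, ψn n (∑ i, (φn n (x i)).toReal) ≠ 0 := by
    obtain ⟨w, hw1, hw2⟩ : ∃ w, ∑ i, (φ (x i)).toReal < w ∧ 0 < ψ w := by
      have hcont : Tendsto ψ (𝓝[>] (∑ i, (φ (x i)).toReal)) (𝓝 (ψ (∑ i, (φ (x i)).toReal))) :=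
        (hgen.continuousOn _ (mem_Ici.2 hs0.le)).mono_left
          (nhdsWithin_mono _ (fun y hy => mem_Ici.2 (hs0.le.trans (le_of_lt hy))))
      obtain ⟨w, h1, h2⟩ := ((hcont.eventually_const_lt hψs).and self_mem_nhdsWithin).exists
      exact ⟨w, h2, h1⟩
    filter_upwards [hsn.eventually_lt_const hw1,
      (hψ w (hs0.trans hw1)).eventually_const_lt hw2] with n hn1 hn2
    rw [div_lt_iff₀ (hc n)] at hn1
    have h0 : 0 ≤ ∑ i, (φn n (x i)).toReal := Finset.sum_nonneg (fun _ _ => ENNReal.toReal_nonneg)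
    have := (hgenn n).antitoneOn (mem_Ici.2 h0)
      (mem_Ici.2 (mul_pos (hc n) (hs0.trans hw1)).le) (by linarith)
    exact (hn2.trans_le this).ne'
  -- scaled chains
  have hch := gen_chain hgen
  have hm : l - 1 ≤ d - 2 := by omega
  have hchn : ∀ n, MChain (d - 2) (fun m z => c n ^ m * gF (ψn n) m (c n * z)) :=
    fun n => (gen_chain (hgenn n)).scale (hc n)
  have hpt := chain_tendsto hchn hch (by
    intro z hz
    simp only [pow_zero, one_mul, gF_zero]
    exact hψ z hz) (l-1) hm
  have hconvx := fun n => (hchn n).conv (l-1) hm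
  have t1 := lDer_tendsto hconvx hpt hs0 hs hsn
  have t2 := lDer_tendsto hconvx hpt (add_pos_of_pos_of_nonneg hs0 hy00) hu hun
  have hne : lDer (gF ψ (l-1)) (∑ i, (φ (x i)).toReal) ≠ 0 :=
    (hch.lDer_neg hs0 (by rw [gF_zero]; exact hψs) (l-1) hm).2.ne
  have t3 := t2.div t1 hne
  rw [archK_eq hgen hl hld hx0 hx1 hy0 hpos]
  refine t3.congr' ?_
  filter_upwards [hev] with n hn
  rw [archK_eq (hgenn n) hl hld hx0 hx1 hy0 hn]
  simp only [Pi.div_apply]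
  rw [lDer_scale (hc n), lDer_scale (hc n), mul_div_cancel₀ _ (hc n).ne',
    mul_div_cancel₀ _ (hc n).ne', mul_div_mul_left _ _ (pow_pos (hc n) _).ne',
    mul_div_mul_left _ _ (hc n).ne']

end kernelconv

/-! ### Weak convergence from boxes -/

/-- Half-open boxes. -/
def hBox {k : ℕ} (J : Finset (Fin k)) (a b : Fin k → ℝ) : Set (Fin k → ℝ) :=
  {t | (∀ i, t i ≤ b i) ∧ ∀ i ∈ J, a i < t i}

lemma hBox_meas {k : ℕ} (J : Finset (Fin k)) (a b : Fin k → ℝ) : MeasurableSet (hBox J a b) := by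
  have : hBox J a b = (⋂ i, {t : Fin k → ℝ | t i ≤ b i}) ∩ ⋂ i ∈ J, {t : Fin k → ℝ | a i < t i} := by
    ext t; simp [hBox]
  rw [this]
  refine MeasurableSet.inter (MeasurableSet.iInter fun i => ?_)
    (Finset.measurableSet_biInter _ fun i _ => ?_)
  · exact measurableSet_le (measurable_pi_apply i) measurable_const
  · exact measurableSet_lt measurable_const (measurable_pi_apply i)

lemma hBox_tendsto {k : ℕ} {μn : ℕ → Measure (Fin k → ℝ)} {μ : Measure (Fin k → ℝ)}
    [∀ n, IsProbabilityMeasure (μn n)] [IsProbabilityMeasure μ] {G : Set ℝ}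
    (h : ∀ y : Fin k → ℝ, (∀ j, y j ∈ G) →
      Tendsto (fun n => (μn n).real (lowerBox y)) atTop (𝓝 (μ.real (lowerBox y))))
    {a : Fin k → ℝ} (ha : ∀ j, a j ∈ G) (J : Finset (Fin k)) :
    ∀ b : Fin k → ℝ, (∀ j, b j ∈ G) →
      Tendsto (fun n => (μn n).real (hBox J a b)) atTop (𝓝 (μ.real (hBox J a b))) := by
  induction J using Finset.induction_on with
  | empty =>
    intro b hb
    have : hBox ∅ a b = lowerBox b := by ext t; simp [hBox, lowerBox]
    rw [this]; exact h b hb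
  | insert j J hj ih =>
    intro b hb
    have hb' : ∀ i, Function.update b j (min (a j) (b j)) i ∈ G := by
      intro i
      by_cases hij : i = j
      · subst hij
        rw [Function.update_self]
        rcases min_choice (a i) (b i) with h | h <;> rw [h]
        · exact ha i
        · exact hb i
      · rw [Function.update_of_ne hij]; exact hb i
    have hsub : hBox J a (Function.update b j (min (a j) (b j))) ⊆ hBox J a b := by
      rintro t ⟨h1, h2⟩
      refine ⟨fun i => ?_, h2⟩
      have := h1 i
      by_cases hij : i = j
      · subst hij
        rw [Function.update_self] at this
        exact this.trans (min_le_right _ _)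
      · rwa [Function.update_of_ne hij] at this
    have hdiff : hBox (insert j J) a b
        = hBox J a b \ hBox J a (Function.update b j (min (a j) (b j))) := by
      ext t
      constructor
      · rintro ⟨h1, h2⟩
        refine ⟨⟨h1, fun i hi => h2 i (Finset.mem_insert_of_mem hi)⟩, fun h3 => ?_⟩
        have h4 := h3.1 j
        rw [Function.update_self] at h4
        have h5 := h2 j (Finset.mem_insert_self _ _)
        exact absurd (h4.trans (min_le_left _ _)) (not_le.2 h5)
      · rintro ⟨⟨h1, h2⟩, h3⟩
        refine ⟨h1, fun i hi => ?_⟩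
        rcases Finset.mem_insert.1 hi with rfl | hi
        · by_contra h4
          push Not at h4
          refine h3 ⟨fun i' => ?_, h2⟩
          by_cases hij : i' = i
          · subst hij
            rw [Function.update_self]
            exact le_min h4 (h1 _)
          · rw [Function.update_of_ne hij]; exact h1 i'
        · exact h2 i hi
    have e : ∀ (m : Measure (Fin k → ℝ)) [IsProbabilityMeasure m], m.real (hBox (insert j J) a b)
        = m.real (hBox J a b) - m.real (hBox J a (Function.update b j (min (a j) (b j)))) := by
      intro m _
      rw [hdiff, measureReal_sdiff hsub (hBox_meas _ _ _)]
    simp only [e]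
    exact (ih b hb).sub (ih _ hb')

lemma weak_of_boxes {k : ℕ} {μn : ℕ → Measure (Fin k → ℝ)} {μ : Measure (Fin k → ℝ)}
    [∀ n, IsProbabilityMeasure (μn n)] [IsProbabilityMeasure μ] {G : Set ℝ} (hG : Dense G)
    (h : ∀ y : Fin k → ℝ, (∀ j, y j ∈ G) →
      Tendsto (fun n => (μn n).real (lowerBox y)) atTop (𝓝 (μ.real (lowerBox y)))) :
    WeakConv μn μ := by
  let P : ℕ → ProbabilityMeasure (Fin k → ℝ) := fun n => ⟨μn n, inferInstance⟩
  let Q : ProbabilityMeasure (Fin k → ℝ) := ⟨μ, inferInstance⟩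
  suffices hPQ : Tendsto P atTop (𝓝 Q) by
    intro f
    exact ProbabilityMeasure.tendsto_iff_forall_integral_tendsto.1 hPQ f
  let S : Set (Set (Fin k → ℝ)) :=
    {s | ∃ a b : Fin k → ℝ, (∀ j, a j ∈ G) ∧ (∀ j, b j ∈ G) ∧ s = hBox Finset.univ a b}
  have hpi : IsPiSystem S := by
    rintro _ ⟨a, b, ha, hb, rfl⟩ _ ⟨a', b', ha', hb', rfl⟩ _
    refine ⟨fun j => max (a j) (a' j), fun j => min (b j) (b' j), ?_, ?_, ?_⟩
    · intro j
      rcases max_choice (a j) (a' j) with h | h <;> simp only [h]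
      · exact ha j
      · exact ha' j
    · intro j
      rcases min_choice (b j) (b' j) with h | h <;> simp only [h]
      · exact hb j
      · exact hb' j
    · ext t
      simp only [hBox, mem_inter_iff, mem_ofPred_eq, Finset.mem_univ, true_imp_iff, le_min_iff,
        max_lt_iff, forall_and]
      tauto
  refine hpi.tendsto_probabilityMeasure_of_tendsto_of_mem ?_ ?_ ?_
  · rintro _ ⟨a, b, ha, hb, rfl⟩
    exact hBox_meas _ _ _
  · intro u hu x hx
    obtain ⟨ε, hε, hball⟩ := Metric.isOpen_iff.1 hu x hx
    choose a haG ha using fun i => hG.exists_between (show x i - ε / 2 < x i by linarith)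
    choose b hbG hb using fun i => hG.exists_between (show x i < x i + ε / 2 by linarith)
    refine ⟨_, ⟨a, b, haG, hbG, rfl⟩, ?_, ?_⟩
    · have : Set.pi univ (fun i => Ioo (a i) (b i)) ∈ 𝓝 x :=
        set_pi_mem_nhds finite_univ (fun i _ => Ioo_mem_nhds (ha i).2 (hb i).1)
      refine mem_of_superset this ?_
      intro t ht
      exact ⟨fun i => (ht i (mem_univ i)).2.le, fun i _ => (ht i (mem_univ i)).1⟩
    · refine subset_trans ?_ hball
      rintro t ⟨h1, h2⟩
      rw [Metric.mem_ball, dist_pi_lt_iff hε]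
      intro i
      rw [Real.dist_eq, abs_lt]
      have h3 := h1 i
      have h4 := h2 i (Finset.mem_univ i)
      have h5 := (ha i).1
      have h6 := (hb i).2
      constructor <;> linarith
  · rintro _ ⟨a, b, ha, hb, rfl⟩
    have := hBox_tendsto h ha Finset.univ b hb
    rw [← NNReal.tendsto_coe]
    exact this

/-! ### Null sets of the marginal -/

/-- Iterated backward differences. -/
def Dl (h : ℝ) : ℕ → (ℝ → ℝ) → ℝ → ℝ
  | 0, g, z => g z
  | k + 1, g, z => Dl h k g z - Dl h k g (z + h)

lemma Dl_hasDerivAt {N : ℕ} {F : ℕ → ℝ → ℝ} (hF : MChain N F) {h : ℝ} (hh : 0 ≤ h) {m : ℕ}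
    (hm : m < N) (k : ℕ) : ∀ z, 0 < z →
      HasDerivAt (Dl h k (F m)) (- Dl h k (F (m+1)) z) z := by
  induction k with
  | zero => intro z hz; exact hF.der m hm z hz
  | succ k ih =>
    intro z hz
    have h1 := ih z hz
    have h2 := (ih (z + h) (by linarith)).comp_add_const z h
    refine (h1.sub h2).congr_deriv ?_
    simp only [Dl]
    ring

lemma Dl_lipschitz {N : ℕ} {F : ℕ → ℝ → ℝ} (hF : MChain N F) {h z0 : ℝ} (hh : 0 ≤ h)
    (hz0 : 0 < z0) (k : ℕ) : ∀ m, m + k = N → ∀ z w, z0 ≤ z → z ≤ w →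
      Dl h k (F m) z - Dl h k (F m) w ≤ (- lDer (F N) z0) * h ^ k * (w - z) := by
  induction k with
  | zero =>
    intro m hm z w hz hzw
    obtain rfl : m = N := by omega
    simp only [Dl, pow_zero, mul_one]
    rcases hzw.eq_or_lt with rfl | hlt
    · simp
    · have h1 := lDer_le_slope (hF.conv m le_rfl) hz0 hz hlt
      rw [le_div_iff₀ (by linarith)] at h1
      linarith
  | succ k ih =>
    intro m hm z w hz hzw
    have hd : ∀ y, 0 < y → HasDerivAt (Dl h (k+1) (F m)) (- Dl h (k+1) (F (m+1)) y) y :=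
      Dl_hasDerivAt hF hh (by omega) (k+1)
    have := (convex_Icc z w).mul_sub_le_image_sub_of_le_deriv (f := Dl h (k+1) (F m))
      (C := -((- lDer (F N) z0) * h ^ (k+1)))
      (fun y hy => (hd y (by linarith [hy.1])).continuousAt.continuousWithinAt)
      (fun y hy => by
        rw [interior_Icc] at hy
        exact (hd y (by linarith [hy.1])).differentiableAt.differentiableWithinAt)
      (fun y hy => by
        rw [interior_Icc] at hy
        rw [(hd y (by linarith [hy.1])).deriv]
        have := ih (m+1) (by omega) y (y + h) (by linarith [hy.1]) (by linarith)
        simp only [Dl]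
        rw [pow_succ]
        nlinarith [this])
      z (left_mem_Icc.2 hzw) w (right_mem_Icc.2 hzw) hzw
    nlinarith [this]

section nullsets
variable {d : ℕ} {ψ : ℝ → ℝ} {φ : ℝ → ℝ≥0∞}

lemma surv (h : IsGenerator d ψ φ) {l : ℕ} {ν : Measure (Fin l → ℝ)}
    (hν : ∀ x ∈ unitCube l, ν (lowerBox x) = ENNReal.ofReal (evalPsi ψ (∑ i, φ (x i))))
    {a : Fin l → ℝ} (ha : ∀ i, 0 ≤ a i) :
    ν (lowerBox (fun i => ψ (a i))) = ENNReal.ofReal (ψ (∑ i, a i)) := by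
  rw [hν _ (fun i => ⟨h.nonneg _ (ha i), gen_le_one h (ha i)⟩)]
  by_cases hp : ∀ i, 0 < ψ (a i)
  · rw [gen_evalPsi_sum h hp]
    simp only [fun i => gen_p_psi h (ha i) (hp i)]
  · push Not at hp
    obtain ⟨i, hi⟩ := hp
    have hi0 : ψ (a i) = 0 := le_antisymm hi (h.nonneg _ (ha i))
    have h1 : a i ≤ ∑ i, a i := Finset.single_le_sum (fun i _ => ha i) (Finset.mem_univ i)
    have h2 := h.antitoneOn (mem_Ici.2 (ha i)) (mem_Ici.2 ((ha i).trans h1)) h1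
    have h3 : φ 0 ≤ ∑ i, φ (ψ (a i)) := by
      rw [← hi0]
      exact Finset.single_le_sum (f := fun i => φ (ψ (a i))) (fun i _ => zero_le) (Finset.mem_univ i)
    rw [gen_evalPsi_phi_zero h h3, le_antisymm (h2.trans hi) (h.nonneg _ ((ha i).trans h1))]

/-- Boxes in survival coordinates. -/
def sbox {l : ℕ} (ψ : ℝ → ℝ) (h : ℝ) (J : Finset (Fin l)) (a : Fin l → ℝ) : Set (Fin l → ℝ) :=
  hBox J (fun i => ψ (a i + h)) (fun i => ψ (a i))

lemma sbox_real (hg : IsGenerator d ψ φ) {l : ℕ} {ν : Measure (Fin l → ℝ)}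
    [IsProbabilityMeasure ν]
    (hν : ∀ x ∈ unitCube l, ν (lowerBox x) = ENNReal.ofReal (evalPsi ψ (∑ i, φ (x i))))
    {h : ℝ} (hh : 0 ≤ h) (J : Finset (Fin l)) : ∀ a : Fin l → ℝ, (∀ i, 0 ≤ a i) →
      ν.real (sbox ψ h J a) = Dl h J.card ψ (∑ i, a i) := by
  induction J using Finset.induction_on with
  | empty =>
    intro a ha
    have : sbox ψ h ∅ a = lowerBox (fun i => ψ (a i)) := by ext t; simp [sbox, hBox, lowerBox]
    rw [this, measureReal_def, surv hg hν ha,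
      ENNReal.toReal_ofReal (hg.nonneg _ (Finset.sum_nonneg fun i _ => ha i))]
    simp [Dl]
  | insert j J hj ih =>
    intro a ha
    set a' : Fin l → ℝ := fun i => a i + if i = j then h else 0 with ha'
    have ha'0 : ∀ i, a i ≤ a' i := by
      intro i; simp only [ha']; split_ifs <;> linarith
    have ha'n : ∀ i, 0 ≤ a' i := fun i => (ha i).trans (ha'0 i)
    have ha'j : a' j = a j + h := by simp [ha']
    have ha'J : ∀ i, i ≠ j → a' i = a i := by
      intro i hi
      simp [ha', hi]
    have hsum : ∑ i, a' i = ∑ i, a i + h := by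
      simp [ha', Finset.sum_add_distrib]
    have hneJ : ∀ i ∈ J, i ≠ j := fun i hi hij => hj (hij ▸ hi)
    have hsub : sbox ψ h J a' ⊆ sbox ψ h J a := by
      rintro t ⟨h1, h2⟩
      refine ⟨fun i => (h1 i).trans (hg.antitoneOn (mem_Ici.2 (ha i)) (mem_Ici.2 (ha'n i)) (ha'0 i)),
        fun i hi => ?_⟩
      have := h2 i hi
      simp only [ha'J i (hneJ i hi)] at this
      exact this
    have hdiff : sbox ψ h (insert j J) a = sbox ψ h J a \ sbox ψ h J a' := by
      ext t
      constructor
      · rintro ⟨h1, h2⟩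
        refine ⟨⟨h1, fun i hi => h2 i (Finset.mem_insert_of_mem hi)⟩, fun h3 => ?_⟩
        have h4 := h3.1 j
        simp only [ha'j] at h4
        exact absurd h4 (not_le.2 (h2 j (Finset.mem_insert_self _ _)))
      · rintro ⟨⟨h1, h2⟩, h3⟩
        refine ⟨h1, fun i hi => ?_⟩
        rcases Finset.mem_insert.1 hi with rfl | hi
        · by_contra h4
          push Not at h4
          refine h3 ⟨fun i' => ?_, fun i' hi' => ?_⟩
          · by_cases hij : i' = i
            · subst hij
              simp only [ha'j]; exact h4
            · simp only [ha'J i' hij]; exact h1 i'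
          · simp only [ha'J i' (hneJ i' hi')]; exact h2 i' hi'
        · exact h2 i hi
    rw [hdiff, measureReal_sdiff hsub (hBox_meas _ _ _), ih a ha, ih a' ha'n, hsum,
      Finset.card_insert_of_notMem hj]
    simp only [Dl]

lemma level_null (hg : IsGenerator d ψ φ) {k : ℕ} (hk : k ≤ d - 2)
    {ν : Measure (Fin (k+1) → ℝ)} [IsProbabilityMeasure ν]
    (hν : ∀ x ∈ unitCube (k+1), ν (lowerBox x) = ENNReal.ofReal (evalPsi ψ (∑ i, φ (x i))))
    {s : ℝ} (hs : 0 < s) :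
    ν {x | (∀ i, 0 < x i ∧ x i < 1) ∧ ∑ i, (φ (x i)).toReal = s} = 0 := by
  set S : Set (Fin (k+1) → ℝ) := {x | (∀ i, 0 < x i ∧ x i < 1) ∧ ∑ i, (φ (x i)).toReal = s} with hS
  have hch : MChain k (gF ψ) := (gen_chain hg).mono hk
  set Lc : ℝ := - lDer (gF ψ k) (s / 2) with hLc
  have hL0 : 0 ≤ Lc := by
    by_contra hc
    push Not at hc
    have h3 : lDer (gF ψ k) (s/2) ≤ 0 := by
      have := lDer_le_slope (hch.conv k le_rfl) (half_pos hs) le_rfl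
        (show s / 2 < s by linarith)
      refine this.trans (div_nonpos_of_nonpos_of_nonneg ?_ (by linarith))
      have := hch.anti k le_rfl (show s/2 ∈ Ioi (0:ℝ) from half_pos hs) (show s ∈ Ioi (0:ℝ) from hs)
        (by linarith)
      linarith
    linarith
  set Cc : ℝ := Lc * (k + 1) * (2 * s) ^ k * s with hCc
  have hC0 : 0 ≤ Cc := by positivity
  have bound : ∀ M : ℕ, 2 * k + 1 ≤ M → ν.real S ≤ Cc / M := by
    intro M hM
    have hM1 : (1:ℝ) ≤ M := by exact_mod_cast (by omega : 1 ≤ M)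
    have hM0 : (0:ℝ) < M := by linarith
    have hM2 : 2 * (k:ℝ) ≤ M := by exact_mod_cast (by omega : 2 * k ≤ M)
    set h : ℝ := s / M with hh
    have hh0 : 0 < h := by positivity
    have hhM : h * M = s := by rw [hh]; field_simp
    let J : Finset (Fin (k+1)) := Finset.univ.erase 0
    have hJc : J.card = k := by simp [J]
    let a : (Fin k → Fin (M+1)) → Fin (k+1) → ℝ := fun f =>
      Fin.cons (max 0 (s - h * ∑ i, ((f i : ℕ) : ℝ) - k * h)) (fun i => h * ((f i : ℕ) : ℝ))
    let b : (Fin k → Fin (M+1)) → Fin (k+1) → ℝ := fun f =>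
      Fin.cons (max 0 (s - h * ∑ i, ((f i : ℕ) : ℝ) + h)) (fun i => h * ((f i : ℕ) : ℝ))
    have ha0 : ∀ f i, 0 ≤ a f i := by
      intro f i
      refine Fin.cases ?_ (fun i => ?_) i
      · simp [a]
      · simp only [a, Fin.cons_succ]; positivity
    have hb0 : ∀ f i, 0 ≤ b f i := by
      intro f i
      refine Fin.cases ?_ (fun i => ?_) i
      · simp [b]
      · simp only [b, Fin.cons_succ]; positivity
    have hab : ∀ f i, a f i ≤ b f i := by
      intro f i
      refine Fin.cases ?_ (fun i => ?_) i
      · simp only [a, b, Fin.cons_zero]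
        refine max_le_max le_rfl ?_
        have : (0:ℝ) ≤ k * h := by positivity
        linarith
      · simp only [a, b, Fin.cons_succ]; exact le_rfl
    have hcover : S ⊆ ⋃ f : Fin k → Fin (M+1), sbox ψ h J (a f) \ sbox ψ h J (b f) := by
      rintro x ⟨hx, hxs⟩
      have ht0 : ∀ i, 0 ≤ (φ (x i)).toReal := fun i => ENNReal.toReal_nonneg
      have hfl : ∀ i : Fin k, ⌊(φ (x i.succ)).toReal / h⌋₊ < M + 1 := by
        intro i
        rw [Nat.lt_succ_iff]
        have : (φ (x i.succ)).toReal ≤ s := by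
          rw [← hxs]
          exact Finset.single_le_sum (f := fun i => (φ (x i)).toReal) (fun i _ => ht0 i)
            (Finset.mem_univ _)
        apply Nat.floor_le_of_le
        rw [div_le_iff₀ hh0]; linarith
      let f : Fin k → Fin (M+1) := fun i => ⟨_, hfl i⟩
      have hf1 : ∀ i, h * ((f i : ℕ) : ℝ) ≤ (φ (x i.succ)).toReal := by
        intro i
        have := Nat.floor_le (div_nonneg (ht0 i.succ) hh0.le)
        rw [le_div_iff₀ hh0] at this
        simp only [f]; linarith
      have hf2 : ∀ i, (φ (x i.succ)).toReal < h * ((f i : ℕ) : ℝ) + h := by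
        intro i
        have := Nat.lt_floor_add_one ((φ (x i.succ)).toReal / h)
        rw [div_lt_iff₀ hh0] at this
        simp only [f]; linarith
      have hsp : (φ (x 0)).toReal + ∑ i : Fin k, (φ (x i.succ)).toReal = s := by
        rw [← hxs, Fin.sum_univ_succ]
      have hs1 : h * ∑ i, ((f i : ℕ) : ℝ) ≤ ∑ i : Fin k, (φ (x i.succ)).toReal := by
        rw [Finset.mul_sum]; exact Finset.sum_le_sum fun i _ => hf1 i
      have hs2 : ∑ i : Fin k, (φ (x i.succ)).toReal ≤ h * ∑ i, ((f i : ℕ) : ℝ) + k * h := by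
        have := Finset.sum_le_sum (s := Finset.univ) fun i _ => (hf2 i).le
        rw [Finset.sum_add_distrib, ← Finset.mul_sum] at this
        simpa using this
      refine mem_iUnion.2 ⟨f, ⟨fun i => ?_, fun i hi => ?_⟩, fun hb => ?_⟩
      · show x i ≤ ψ (a f i)
        rw [gen_le_iff hg (hx i).1 (hx i).2.le (ha0 f i)]
        refine Fin.cases ?_ (fun i => ?_) i
        · simp only [a, Fin.cons_zero]
          exact max_le (ht0 0) (by linarith)
        · simp only [a, Fin.cons_succ]; exact hf1 i
      · show ψ (a f i + h) < x i
        rw [gen_lt_iff hg (hx i).1 (hx i).2.le (add_nonneg (ha0 f i) hh0.le)]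
        have hi0 : i ≠ 0 := by simpa [J] using hi
        obtain ⟨i', rfl⟩ := Fin.exists_succ_eq.2 hi0
        simp only [a, Fin.cons_succ]; exact hf2 i'
      · have h1 : x 0 ≤ ψ (b f 0) := hb.1 0
        rw [gen_le_iff hg (hx 0).1 (hx 0).2.le (hb0 f 0)] at h1
        simp only [b, Fin.cons_zero] at h1
        have := (le_max_right _ _).trans h1
        linarith
    have hmass : ∀ f : Fin k → Fin (M+1),
        ν.real (sbox ψ h J (a f) \ sbox ψ h J (b f)) ≤ Lc * h ^ k * ((k + 1) * h) := by
      intro f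
      have hsub : sbox ψ h J (b f) ⊆ sbox ψ h J (a f) := by
        rintro t ⟨h1, h2⟩
        refine ⟨fun i => (h1 i).trans (hg.antitoneOn (mem_Ici.2 (ha0 f i)) (mem_Ici.2 (hb0 f i))
          (hab f i)), fun i hi => ?_⟩
        have hi0 : i ≠ 0 := by simpa [J] using hi
        obtain ⟨i', rfl⟩ := Fin.exists_succ_eq.2 hi0
        exact h2 _ hi
      rw [measureReal_sdiff hsub (hBox_meas _ _ _), sbox_real hg hν hh0.le J _ (ha0 f),
        sbox_real hg hν hh0.le J _ (hb0 f), hJc]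
      have hp : (0:ℝ) ≤ k * h := by positivity
      have hkh : k * h ≤ s / 2 := by
        have : 2 * (k:ℝ) * h ≤ M * h := mul_le_mul_of_nonneg_right hM2 hh0.le
        linarith
      have hsa : ∑ i, a f i = max 0 (s - h * ∑ i, ((f i : ℕ) : ℝ) - k * h)
          + h * ∑ i, ((f i : ℕ) : ℝ) := by
        rw [Fin.sum_univ_succ]; simp only [a, Fin.cons_zero, Fin.cons_succ]; rw [Finset.mul_sum]
      have hsb : ∑ i, b f i = max 0 (s - h * ∑ i, ((f i : ℕ) : ℝ) + h)
          + h * ∑ i, ((f i : ℕ) : ℝ) := by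
        rw [Fin.sum_univ_succ]; simp only [b, Fin.cons_zero, Fin.cons_succ]; rw [Finset.mul_sum]
      have h1 : s / 2 ≤ ∑ i, a f i := by
        rw [hsa]
        have := le_max_right 0 (s - h * ∑ i, ((f i : ℕ) : ℝ) - k * h)
        linarith
      have h2 : ∑ i, a f i ≤ ∑ i, b f i := Finset.sum_le_sum fun i _ => hab f i
      have h3 : ∑ i, b f i - ∑ i, a f i ≤ (k + 1) * h := by
        rw [hsa, hsb]
        have h4 := le_max_right 0 (s - h * ∑ i, ((f i : ℕ) : ℝ) - k * h)
        have h5 := le_max_left 0 (s - h * ∑ i, ((f i : ℕ) : ℝ) - k * h)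
        have h6 : max 0 (s - h * ∑ i, ((f i : ℕ) : ℝ) + h)
            ≤ max 0 (s - h * ∑ i, ((f i : ℕ) : ℝ) - k * h) + (k+1) * h :=
          max_le (by nlinarith) (by linarith)
        linarith
      have h4 := Dl_lipschitz hch hh0.le (half_pos hs) k 0 (by omega) _ _ h1 h2
      rw [gF_zero] at h4
      exact h4.trans (mul_le_mul_of_nonneg_left h3 (by positivity))
    calc ν.real S ≤ ν.real (⋃ f : Fin k → Fin (M+1), sbox ψ h J (a f) \ sbox ψ h J (b f)) :=
          measureReal_mono hcover
      _ ≤ ∑ f : Fin k → Fin (M+1), ν.real (sbox ψ h J (a f) \ sbox ψ h J (b f)) :=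
          measureReal_iUnion_fintype_le _
      _ ≤ ∑ f : Fin k → Fin (M+1), Lc * h ^ k * ((k + 1) * h) :=
          Finset.sum_le_sum fun f _ => hmass f
      _ = Lc * (k + 1) * (((M + 1) * h) ^ k) * h := by
          simp
          rw [mul_pow]; ring
      _ ≤ Lc * (k + 1) * ((2 * s) ^ k) * h := by
          have h5 : (M + 1) * h ≤ 2 * s := by nlinarith
          exact mul_le_mul_of_nonneg_right (mul_le_mul_of_nonneg_left
            (pow_le_pow_left₀ (by positivity) h5 k) (by positivity)) hh0.le
      _ = Cc / M := by rw [hCc, hh]; ring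
  by_contra hne
  have hpos : 0 < ν.real S := by
    rw [measureReal_def]
    exact ENNReal.toReal_pos hne (measure_ne_top _ _)
  obtain ⟨n, hn⟩ := exists_nat_gt (Cc / ν.real S)
  have h1 := bound (n + (2 * k + 1)) (by omega)
  have h2 : (0:ℝ) < ((n + (2 * k + 1) : ℕ) : ℝ) := by exact_mod_cast (by omega)
  rw [le_div_iff₀ h2] at h1
  rw [div_lt_iff₀ hpos] at hn
  have h3 : (n:ℝ) ≤ ((n + (2 * k + 1) : ℕ) : ℝ) := by exact_mod_cast (by omega)
  nlinarith

end nullsets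

section good
variable {d : ℕ} {ψ : ℝ → ℝ} {φ : ℝ → ℝ≥0∞}

lemma lowerBox_meas {k : ℕ} (b : Fin k → ℝ) : MeasurableSet (lowerBox b) := by
  have : hBox ∅ b b = lowerBox b := by ext t; simp [hBox, lowerBox]
  rw [← this]; exact hBox_meas _ _ _

lemma good_cube (hg : IsGenerator d ψ φ) {l : ℕ} {ν : Measure (Fin l → ℝ)}
    [IsProbabilityMeasure ν]
    (hν : ∀ x ∈ unitCube l, ν (lowerBox x) = ENNReal.ofReal (evalPsi ψ (∑ i, φ (x i)))) :
    ∀ᵐ x ∂ν, ∀ i, 0 < x i ∧ x i < 1 := by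
  rw [ae_all_iff]
  intro i
  have hone : ∀ᵐ x ∂ν, x ∈ lowerBox (fun _ : Fin l => (1:ℝ)) := by
    have h1 := surv hg hν (a := fun _ => 0) (fun _ => le_rfl)
    simp only [hg.at_zero, Finset.sum_const_zero, ENNReal.ofReal_one] at h1
    exact (prob_compl_eq_zero_iff (lowerBox_meas _)).2 h1
  have hzero : ∀ᵐ x ∂ν, x ∉ lowerBox (Function.update (fun _ : Fin l => (1:ℝ)) i 0) := by
    rw [ae_iff]
    simp only [not_not]
    have h1 := hν (Function.update (fun _ : Fin l => (1:ℝ)) i 0) (by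
      intro j
      by_cases hj : j = i
      · subst hj; simp
      · simp [Function.update_of_ne hj])
    rw [gen_evalPsi_phi_zero hg, ENNReal.ofReal_zero] at h1
    · exact h1
    · have := Finset.single_le_sum
        (f := fun j => φ (Function.update (fun _ : Fin l => (1:ℝ)) i 0 j))
        (fun j _ => zero_le) (Finset.mem_univ i)
      simpa using this
  have htop : ν {x | 1 ≤ x i} = 0 := by
    have hb : ∀ t : ℝ, 0 < t → t < 1 → ν.real {x | 1 ≤ x i} ≤ 1 - t := by
      intro t h0 h1
      have hs := surv hg hν (a := fun j => if j = i then (φ t).toReal else 0) (by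
        intro j; split_ifs
        · exact ENNReal.toReal_nonneg
        · exact le_rfl)
      simp only [Finset.sum_ite_eq', Finset.mem_univ, if_true, gen_psi_p hg h0 h1.le] at hs
      have hsub : {x : Fin l → ℝ | 1 ≤ x i} ⊆
          (lowerBox (fun j => ψ (if j = i then (φ t).toReal else 0)))ᶜ := by
        intro x hx hc
        have := hc i
        simp only [if_true, gen_psi_p hg h0 h1.le] at this
        have hx' : 1 ≤ x i := hx
        linarith
      refine (measureReal_mono hsub).trans ?_
      rw [probReal_compl_eq_one_sub (lowerBox_meas _), measureReal_def, hs,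
        ENNReal.toReal_ofReal h0.le]
    by_contra hne
    have hpos : 0 < ν.real {x | 1 ≤ x i} := by
      rw [measureReal_def]
      exact ENNReal.toReal_pos hne (measure_ne_top _ _)
    set δ := ν.real {x | 1 ≤ x i}
    have h1 := hb (1 - min (δ/2) (1/2)) (by
      have := min_le_right (δ/2) (1/2); linarith) (by
      have : 0 < min (δ/2) (1/2) := lt_min (by linarith) (by norm_num)
      linarith)
    have := min_le_left (δ/2) (1/2)
    linarith
  have htop' : ∀ᵐ x ∂ν, ¬ 1 ≤ x i := by
    rw [ae_iff]; simpa only [not_not] using htop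
  filter_upwards [hone, hzero, htop'] with x h1 h2 h3
  refine ⟨?_, not_le.1 h3⟩
  by_contra h4
  push Not at h4
  refine h2 (fun j => ?_)
  by_cases hj : j = i
  · subst hj; simpa using h4
  · rw [Function.update_of_ne hj]; exact h1 j

lemma level_countable (hg : IsGenerator d ψ φ) {l : ℕ} (hl : 1 ≤ l) (hld : l ≤ d - 1)
    {ν : Measure (Fin l → ℝ)} [IsProbabilityMeasure ν]
    (hν : ∀ x ∈ unitCube l, ν (lowerBox x) = ENNReal.ofReal (evalPsi ψ (∑ i, φ (x i))))
    {D : Set ℝ} (hD : D.Countable) (hD0 : ∀ s ∈ D, 0 < s) :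
    ∀ᵐ x ∂ν, (∀ i, 0 < x i ∧ x i < 1) → ∑ i, (φ (x i)).toReal ∉ D := by
  obtain ⟨k, rfl⟩ : ∃ k, l = k + 1 := ⟨l - 1, by omega⟩
  have h1 : ∀ᵐ x ∂ν, ∀ s ∈ D, ¬ ((∀ i, 0 < x i ∧ x i < 1) ∧ ∑ i, (φ (x i)).toReal = s) := by
    rw [ae_ball_iff hD]
    intro s hs
    rw [ae_iff]
    simp only [not_not]
    exact level_null hg (by omega) hν (hD0 s hs)
  filter_upwards [h1] with x hx hx1 hx2
  exact hx _ hx2 ⟨hx1, rfl⟩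

lemma good_pos (hg : IsGenerator d ψ φ) {l : ℕ} (hl : 1 ≤ l) (hld : l ≤ d - 1)
    {ν : Measure (Fin l → ℝ)} [IsProbabilityMeasure ν]
    (hν : ∀ x ∈ unitCube l, ν (lowerBox x) = ENNReal.ofReal (evalPsi ψ (∑ i, φ (x i)))) :
    ∀ᵐ x ∂ν, (∀ i, 0 < x i ∧ x i < 1) → ψ (∑ i, (φ (x i)).toReal) ≠ 0 := by
  let Z : Set ℝ := {z | 0 < z ∧ ψ z = 0 ∧ ∀ w, 0 ≤ w → w < z → ψ w ≠ 0}
  have hZ : Z.Subsingleton := by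
    rintro a ⟨ha0, ha1, ha2⟩ b ⟨hb0, hb1, hb2⟩
    rcases lt_trichotomy a b with h | h | h
    · exact absurd ha1 (hb2 a ha0.le h)
    · exact h
    · exact absurd hb1 (ha2 b hb0.le h)
  have h1 := level_countable hg hl hld hν hZ.countable (fun s hs => hs.1)
  have h2 : ∀ᵐ x ∂ν, ∀ r : Fin l → ℚ, (∀ i, 0 ≤ r i) → ψ (∑ i, (r i : ℝ)) = 0 →
      x ∉ lowerBox (fun i => ψ (r i)) := by
    rw [ae_all_iff]
    intro r
    by_cases hr : (∀ i, 0 ≤ r i) ∧ ψ (∑ i, (r i : ℝ)) = 0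
    · have := surv hg hν (a := fun i => (r i : ℝ)) (fun i => by exact_mod_cast hr.1 i)
      rw [hr.2, ENNReal.ofReal_zero] at this
      have h3 : ∀ᵐ x ∂ν, x ∉ lowerBox (fun i => ψ (r i)) := by
        rw [ae_iff]; simp only [not_not]; exact this
      filter_upwards [h3] with x hx _ _ using hx
    · exact Filter.Eventually.of_forall fun x h4 h5 => absurd ⟨h4, h5⟩ hr
  filter_upwards [h1, h2] with x hx1 hx2 hx hz
  have hne : (Finset.univ : Finset (Fin l)).Nonempty := ⟨⟨0, hl⟩, Finset.mem_univ _⟩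
  have ht : ∀ i, 0 < (φ (x i)).toReal := fun i => gen_p_pos hg (hx i).1 (hx i).2
  have hs0 : 0 < ∑ i, (φ (x i)).toReal := Finset.sum_pos (fun i _ => ht i) hne
  have hnZ := hx1 hx
  have : ∃ w, 0 ≤ w ∧ w < ∑ i, (φ (x i)).toReal ∧ ψ w = 0 := by
    by_contra hc
    push Not at hc
    exact hnZ ⟨hs0, hz, hc⟩
  obtain ⟨z, hz0, hzs, hzz⟩ := this
  have hl0 : (0:ℝ) < l := by exact_mod_cast hl
  set δ := (∑ i, (φ (x i)).toReal - z) / l with hδ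
  have hδ0 : 0 < δ := div_pos (by linarith) hl0
  have hr : ∀ i, ∃ r : ℚ, max 0 ((φ (x i)).toReal - δ) < (r:ℝ) ∧ (r:ℝ) < (φ (x i)).toReal :=
    fun i => exists_rat_btwn (max_lt (ht i) (by linarith))
  choose r hr1 hr2 using hr
  have hr0 : ∀ i, (0:ℝ) ≤ r i := fun i => (le_max_left _ _).trans (hr1 i).le
  have hsum : z ≤ ∑ i, (r i : ℝ) := by
    have h3 : ∑ i, ((φ (x i)).toReal - δ) ≤ ∑ i, (r i : ℝ) :=
      Finset.sum_le_sum fun i _ => (le_max_right _ _).trans (hr1 i).le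
    rw [Finset.sum_sub_distrib] at h3
    simp only [Finset.sum_const, Finset.card_univ, Fintype.card_fin, nsmul_eq_mul] at h3
    have : (l:ℝ) * δ = ∑ i, (φ (x i)).toReal - z := by rw [hδ]; field_simp
    linarith
  refine hx2 r (fun i => by exact_mod_cast hr0 i) ?_ (fun i => ?_)
  · have := hg.antitoneOn (mem_Ici.2 hz0) (mem_Ici.2 (hz0.trans hsum)) hsum
    rw [hzz] at this
    exact le_antisymm this (hg.nonneg _ (hz0.trans hsum))
  · show x i ≤ ψ (r i)
    rw [gen_le_iff hg (hx i).1 (hx i).2.le (hr0 i)]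
    exact (hr2 i).le

lemma good_ae (hg : IsGenerator d ψ φ) {l : ℕ} (hl : 1 ≤ l) (hld : l ≤ d - 1)
    {ν : Measure (Fin l → ℝ)} [IsProbabilityMeasure ν]
    (hν : ∀ x ∈ unitCube l, ν (lowerBox x) = ENNReal.ofReal (evalPsi ψ (∑ i, φ (x i)))) :
    ∀ᵐ x ∂ν, (∀ i, 0 < x i ∧ x i < 1) ∧ ψ (∑ i, (φ (x i)).toReal) ≠ 0 ∧
      DifferentiableAt ℝ (gF ψ (l-1)) (∑ i, (φ (x i)).toReal) := by
  have hD := countable_not_diff ((gen_chain hg).conv (l-1) (by omega))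
  filter_upwards [good_cube hg hν, good_pos hg hl hld hν,
    level_countable hg hl hld hν hD (fun s hs => hs.1)] with x h1 h2 h3
  refine ⟨h1, h2 h1, ?_⟩
  by_contra hc
  exact h3 h1 ⟨Finset.sum_pos (fun i _ => gen_p_pos hg (h1 i).1 (h1 i).2)
    ⟨⟨0, hl⟩, Finset.mem_univ _⟩, hc⟩

lemma exists_good_set (hg : IsGenerator d ψ φ) {l : ℕ} (hl : 1 ≤ l) (hld : l ≤ d - 1)
    {s : ℝ} (hs : 0 < s) (hsd : DifferentiableAt ℝ (gF ψ (l-1)) s) :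
    ∃ G : Set ℝ, G ⊆ Ioc 0 1 ∧ 1 ∈ G ∧ Icc 0 1 ⊆ closure G ∧
      ∀ y : Fin (d - l) → ℝ, (∀ j, y j ∈ G) →
        DifferentiableAt ℝ (gF ψ (l-1)) (s + ∑ j, (φ (y j)).toReal) := by
  by_cases hl1 : l = d - 1
  · let D : Set ℝ := {x | 0 < x ∧ ¬ DifferentiableAt ℝ (gF ψ (l-1)) x}
    have hD : D.Countable := countable_not_diff ((gen_chain hg).conv (l-1) (by omega))
    let E : Set ℝ := {y | y ∈ Ioc (0:ℝ) 1 ∧ s + (φ y).toReal ∈ D}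
    have hE : E.Countable := by
      refine MapsTo.countable_of_injOn (f := fun y => s + (φ y).toReal) (t := D)
        (fun y hy => hy.2) ?_ hD
      intro a ha b hb hab
      have hab' : (φ a).toReal = (φ b).toReal := by simpa using hab
      rw [← gen_psi_p hg ha.1.1 ha.1.2, ← gen_psi_p hg hb.1.1 hb.1.2, hab']
    refine ⟨Ioc 0 1 \ E, sdiff_subset, ⟨by simp, fun h1 => ?_⟩, ?_, ?_⟩
    · have := h1.2.2
      rw [hg.phi_one] at this
      exact this (by simpa using hsd)
    · have hden : Dense Eᶜ := hE.dense_compl ℝ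
      have h2 : closure (Ioo (0:ℝ) 1) = Icc 0 1 := closure_Ioo (by norm_num)
      rw [← h2]
      have h3 := hden.open_subset_closure_inter (isOpen_Ioo (a := (0:ℝ)) (b := 1))
      refine closure_minimal (h3.trans (closure_mono ?_)) isClosed_closure
      rintro y ⟨hy1, hy2⟩
      exact ⟨⟨hy1.1, hy1.2.le⟩, hy2⟩
    · intro y hy
      have hdl : d - l = 1 := by omega
      have : ∃ j : Fin (d - l), ∑ j, (φ (y j)).toReal = (φ (y j)).toReal := by
        refine ⟨⟨0, by omega⟩, ?_⟩
        refine Finset.sum_eq_single _ (fun b _ hb => ?_) (fun h => absurd (Finset.mem_univ _) h)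
        exact absurd (Fin.ext (by have := b.2; simp only []; omega)) hb
      obtain ⟨j, hj⟩ := this
      rw [hj]
      by_contra hc
      exact (hy j).2 ⟨(hy j).1, add_pos_of_pos_of_nonneg hs ENNReal.toReal_nonneg, hc⟩
  · refine ⟨Ioc 0 1, subset_rfl, by simp, ?_, ?_⟩
    · rw [closure_Ioc (by norm_num)]
    · intro y _
      exact (gF_hasDerivAt hg (by omega) (add_pos_of_pos_of_nonneg hs
        (Finset.sum_nonneg fun j _ => ENNReal.toReal_nonneg))).differentiableAt

end good

lemma exists_full_set {α : Type*} [MeasurableSpace α] {ν : Measure α} [IsProbabilityMeasure ν]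
    {p : α → Prop} (h : ∀ᵐ x ∂ν, p x) :
    ∃ S : Set α, (∀ x ∈ S, p x) ∧ MeasurableSet S ∧ ν S = 1 := by
  refine ⟨(toMeasurable ν {x | ¬ p x})ᶜ, fun x hx => ?_, (measurableSet_toMeasurable _ _).compl, ?_⟩
  · by_contra hc
    exact hx (subset_toMeasurable ν _ hc)
  · rw [prob_compl_eq_one_iff (measurableSet_toMeasurable _ _), measure_toMeasurable]
    exact h

lemma unitCube_meas (k : ℕ) : MeasurableSet (unitCube k) := by
  have : unitCube k = Set.pi univ (fun _ => Icc (0:ℝ) 1) := by ext t; simp [unitCube, Set.mem_pi, -Set.pi_univ_Icc]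
  rw [this]
  exact MeasurableSet.pi countable_univ (fun _ _ => measurableSet_Icc)

lemma lowerBox_neg {k : ℕ} {m : Measure (Fin k → ℝ)} [IsProbabilityMeasure m]
    (hm : m (unitCube k) = 1) {y : Fin k → ℝ} {j : Fin k} (hj : y j < 0) :
    m.real (lowerBox y) = 0 := by
  have h0 : m (unitCube k)ᶜ = 0 := (prob_compl_eq_zero_iff (unitCube_meas k)).2 hm
  rw [measureReal_def, measure_mono_null _ h0, ENNReal.toReal_zero]
  intro t ht hc
  have h1 := ht j
  have h2 := (hc j).1
  linarith

lemma lowerBox_min {k : ℕ} {m : Measure (Fin k → ℝ)} [IsProbabilityMeasure m]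
    (hm : m (unitCube k) = 1) {y : Fin k → ℝ} :
    m (lowerBox y) = m (lowerBox (fun j => min (y j) 1)) := by
  have h0 : ∀ᵐ t ∂m, t ∈ unitCube k := (prob_compl_eq_zero_iff (unitCube_meas k)).2 hm
  refine measure_congr ?_
  filter_upwards [h0] with t ht
  apply propext
  show (∀ j, t j ≤ y j) ↔ ∀ j, t j ≤ min (y j) 1
  exact ⟨fun h j => le_min (h j) (ht j).2, fun h j => (h j).trans (min_le_left _ _)⟩


/-- **Corollary 4.4.** If the `d`-dimensional Archimedean copulas `C_n` converge
uniformly to the Archimedean copula `C`, then for every `ℓ ∈ {1,…,d-1}` there is a set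
`Λ` of full `μ_{C^{1:ℓ}}`-measure such that for every `x ∈ Λ` the `ℓ`-Markov kernels
satisfy `K_n(x,[0,y]) → K_ψ(x,[0,y])` for all `y` in a dense subset `Uˣ` of
`[0,1]^{d-ℓ}`; in particular `C_n → C` `ℓ`-weakly conditional for every
`ℓ ∈ {1,…,d-1}`. -/
theorem arch_uniform_implies_weak_conditional_all_levels
    (d : ℕ) (hd : 2 ≤ d)
    (ψ : ℝ → ℝ) (φ : ℝ → ℝ≥0∞) (hgen : IsGenerator d ψ φ)
    (ψn : ℕ → ℝ → ℝ) (φn : ℕ → ℝ → ℝ≥0∞) (hgenn : ∀ n, IsGenerator d (ψn n) (φn n))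
    (hconv : TendstoUniformlyOn
      (fun n (x : Fin d → ℝ) => evalPsi (ψn n) (∑ i, φn n (x i)))
      (fun x : Fin d → ℝ => evalPsi ψ (∑ i, φ (x i))) atTop (unitCube d)) :
    ∀ l : ℕ, 1 ≤ l → l ≤ d - 1 →
      ∀ ν : Measure (Fin l → ℝ), IsProbabilityMeasure ν →
        (∀ x ∈ unitCube l, ν (lowerBox x) = ENNReal.ofReal (evalPsi ψ (∑ i, φ (x i)))) →
        -- convergence of the explicit kernels on a dense set of boxes:
        ((∃ Λ : Set (Fin l → ℝ), MeasurableSet Λ ∧ ν Λ = 1 ∧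
          ∀ x ∈ Λ, ∃ U ⊆ unitCube (d - l), unitCube (d - l) ⊆ closure U ∧
            ∀ y ∈ U, Tendsto (fun n => archK d l (ψn n) (φn n) x y) atTop
              (nhds (archK d l ψ φ x y))) ∧
        -- in particular, `ℓ`-weak conditional convergence:
        (∀ (K : Kernel (Fin l → ℝ) (Fin (d - l) → ℝ))
            (Kn : ℕ → Kernel (Fin l → ℝ) (Fin (d - l) → ℝ)),
          IsMarkovKernel K → (∀ n, IsMarkovKernel (Kn n)) →
          (∀ x ∈ unitCube l, ∀ y ∈ unitCube (d - l),
            K x (lowerBox y) = ENNReal.ofReal (archK d l ψ φ x y)) →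
          (∀ n, ∀ x ∈ unitCube l, ∀ y ∈ unitCube (d - l),
            Kn n x (lowerBox y) = ENNReal.ofReal (archK d l (ψn n) (φn n) x y)) →
          (∀ x ∈ unitCube l, K x (unitCube (d - l)) = 1) →
          (∀ n, ∀ x ∈ unitCube l, Kn n x (unitCube (d - l)) = 1) →
          ∃ Λ : Set (Fin l → ℝ), MeasurableSet Λ ∧ ν Λ = 1 ∧
            ∀ x ∈ Λ, WeakConv (fun n => Kn n x) (K x))) := by
  intro l hl hld ν hνp hν
  have hae := good_ae hgen hl hld hν
  obtain ⟨Λ, hΛ, hΛm, hΛ1⟩ := exists_full_set hae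
  refine ⟨⟨Λ, hΛm, hΛ1, fun x hx => ?_⟩, ?_⟩
  · obtain ⟨hx01, hpos, hdiff⟩ := hΛ x hx
    have hs0 : 0 < ∑ i, (φ (x i)).toReal :=
      Finset.sum_pos (fun i _ => gen_p_pos hgen (hx01 i).1 (hx01 i).2) ⟨⟨0, hl⟩, Finset.mem_univ _⟩
    obtain ⟨G, hG1, -, hGc, hGd⟩ := exists_good_set hgen hl hld hs0 hdiff
    refine ⟨{y | ∀ j, y j ∈ G}, fun y hy j => ⟨(hG1 (hy j)).1.le, (hG1 (hy j)).2⟩, ?_, ?_⟩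
    · have e : {y : Fin (d - l) → ℝ | ∀ j, y j ∈ G} = Set.pi univ (fun _ => G) := by
        ext y; simp
      rw [e, closure_pi_set]
      exact fun y hy j _ => hGc (hy j)
    · intro y hy
      exact archK_tendsto hd hgen hgenn hconv hl hld (fun i => (hx01 i).1) (fun i => (hx01 i).2)
        (fun j => (hG1 (hy j)).1) (fun j => (hG1 (hy j)).2) hpos hdiff (hGd y hy)
  · intro K Kn hK hKn hKf hKnf hK1 hKn1
    refine ⟨Λ, hΛm, hΛ1, fun x hx => ?_⟩
    obtain ⟨hx01, hpos, hdiff⟩ := hΛ x hx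
    have hs0 : 0 < ∑ i, (φ (x i)).toReal :=
      Finset.sum_pos (fun i _ => gen_p_pos hgen (hx01 i).1 (hx01 i).2) ⟨⟨0, hl⟩, Finset.mem_univ _⟩
    obtain ⟨G, hG1, h1G, hGc, hGd⟩ := exists_good_set hgen hl hld hs0 hdiff
    have hxc : x ∈ unitCube l := fun i => ⟨(hx01 i).1.le, (hx01 i).2.le⟩
    have hGden : Dense (G ∪ Iio 0 ∪ Ioi 1) := by
      intro z
      rcases lt_or_ge z 0 with h0 | h0
      · exact subset_closure (Or.inl (Or.inr h0))
      · rcases lt_or_ge 1 z with h1 | h1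
        · exact subset_closure (Or.inr h1)
        · exact closure_mono (fun y hy => Or.inl (Or.inl hy)) (hGc ⟨h0, h1⟩)
    refine weak_of_boxes hGden (fun y hy => ?_)
    by_cases hneg : ∃ j, y j < 0
    · obtain ⟨j, hj⟩ := hneg
      have hz : ∀ m : Measure (Fin (d - l) → ℝ), IsProbabilityMeasure m →
          m (unitCube (d - l)) = 1 → m.real (lowerBox y) = 0 :=
        fun m _ hm => lowerBox_neg hm hj
      simp only [hz (K x) inferInstance (hK1 x hxc), fun n => hz (Kn n x) inferInstance (hKn1 n x hxc)]
      exact tendsto_const_nhds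
    · push Not at hneg
      have hy' : ∀ j, min (y j) 1 ∈ G := by
        intro j
        rcases hy j with (h | h) | h
        · rw [min_eq_left (hG1 h).2]; exact h
        · exact absurd h (not_lt.2 (hneg j))
        · rw [min_eq_right (le_of_lt h)]; exact h1G
      have hyc : (fun j => min (y j) 1) ∈ unitCube (d - l) :=
        fun j => ⟨(hG1 (hy' j)).1.le, (hG1 (hy' j)).2⟩
      have ht := archK_tendsto hd hgen hgenn hconv hl hld (fun i => (hx01 i).1)
        (fun i => (hx01 i).2) (fun j => (hG1 (hy' j)).1) (fun j => (hG1 (hy' j)).2) hpos hdiff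
        (hGd _ hy')
      have ht2 := (ENNReal.continuous_ofReal.tendsto _).comp ht
      have ht3 := (ENNReal.tendsto_toReal ENNReal.ofReal_ne_top).comp ht2
      have e1 : (K x).real (lowerBox y)
          = (ENNReal.ofReal (archK d l ψ φ x (fun j => min (y j) 1))).toReal := by
        rw [measureReal_def, lowerBox_min (hK1 x hxc), hKf x hxc _ hyc]
      have e2 : ∀ n, (Kn n x).real (lowerBox y)
          = (ENNReal.ofReal (archK d l (ψn n) (φn n) x (fun j => min (y j) 1))).toReal := by
        intro n
        rw [measureReal_def, lowerBox_min (hKn1 n x hxc), hKnf n x hxc _ hyc]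
      simp only [e1, e2]
      exact ht3
end
end

section
/- Let C be a d-dimensional Archimedean copula. Then μ_C is singular with respect to λ_d if, and only if, for every ℓ ∈ {1,…,d−1} there exists a set Λ_ℓ ∈ B([0,1]^ℓ) with μ_{C^{1:ℓ}}(Λ_ℓ) = 1 such that for every x ∈ Λ_ℓ the conditional distribution K_C(x,·) on B([0,1]^{d−ℓ}) is singular with respect to λ_{d−ℓ}. -/
open MeasureTheory ProbabilityTheory Set Filter Topology
open scoped ENNReal

noncomputable section
attribute [local instance] Classical.propDecidable

lemma aux_slope {s : Set ℝ} {g : ℝ → ℝ} (hg : ConvexOn ℝ s g) {x y z w : ℝ} (hx : x ∈ s)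
    (hw : w ∈ s) (hxy : x < y) (hyz : y ≤ z) (hzw : z < w) :
    (g y - g x) / (y - x) ≤ (g w - g z) / (w - z) := by
  have hs := hg.1.ordConnected
  have hy : y ∈ s := hs.out hx hw ⟨hxy.le, hyz.trans hzw.le⟩
  have hz : z ∈ s := hs.out hx hw ⟨hxy.le.trans hyz, hzw.le⟩
  rcases hyz.eq_or_lt with h | h
  · subst h
    exact hg.slope_mono_adjacent hx hw hxy hzw
  · exact (hg.slope_mono_adjacent hx hz hxy h).trans (hg.slope_mono_adjacent hy hw h hzw)

/-- Iterated differences of order `m` are bounded by `L` times the product of the steps. -/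
def DiffBd (ε : ℝ) : ℕ → ℝ → (ℝ → ℝ) → Prop
  | 0, L, G => ∀ x, ε ≤ x → |G x| ≤ L
  | m + 1, L, G => ∀ h, 0 ≤ h → DiffBd ε m (L * h) (fun x => G x - G (x + h))

lemma DiffBd.of_deriv {ε : ℝ} (m : ℕ) : ∀ (L : ℝ) (G G' : ℝ → ℝ),
    (∀ x, ε ≤ x → HasDerivAt G (G' x) x) → DiffBd ε m L G' → DiffBd ε (m + 1) L G := by
  induction m with
  | zero =>
    intro L G G' hG hb h hh x hx
    have := norm_image_sub_le_of_norm_deriv_le_segment' (a := x) (b := x + h) (f := G) (f' := G')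
      (C := L) (fun y hy => (hG y (hx.trans hy.1)).hasDerivWithinAt)
      (fun y hy => hb y (hx.trans hy.1)) (x + h) ⟨by linarith, le_rfl⟩
    rw [Real.norm_eq_abs, abs_sub_comm] at this
    simpa using this
  | succ m ih =>
    intro L G G' hG hb h hh
    refine ih (L * h) _ (fun x => G' x - G' (x + h)) ?_ (hb h hh)
    intro x hx
    exact (hG x hx).sub ((hG (x + h) (by linarith)).comp_add_const x h)

lemma gen_hasDeriv {d : ℕ} {ψ : ℝ → ℝ} {φ : ℝ → ℝ≥0∞} (hgen : IsGenerator d ψ φ)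
    (m : ℕ) (hm : m < d - 2) (z : ℝ) (hz : 0 < z) :
    HasDerivAt (iteratedDeriv m ψ) (iteratedDeriv (m + 1) ψ z) z := by
  have h : DifferentiableAt ℝ (iteratedFDeriv ℝ m ψ) z :=
    (hgen.smooth z hz).differentiableAt_iteratedFDeriv (by exact_mod_cast hm)
  have h2 : DifferentiableAt ℝ (iteratedDeriv m ψ) z := by
    unfold iteratedDeriv
    fun_prop
  rw [iteratedDeriv_succ]
  exact h2.hasDerivAt

lemma gen_conv {d : ℕ} {ψ : ℝ → ℝ} {φ : ℝ → ℝ≥0∞} (hgen : IsGenerator d ψ φ) (k : ℕ) :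
    ∀ m, m + k = d - 2 →
      AntitoneOn (fun z => (-1 : ℝ) ^ m * iteratedDeriv m ψ z) (Ioi 0) ∧
      ConvexOn ℝ (Ioi 0) (fun z => (-1 : ℝ) ^ m * iteratedDeriv m ψ z) := by
  induction k with
  | zero =>
    intro m hm
    have : m = d - 2 := by omega
    subst this
    exact ⟨hgen.top_antitone, hgen.top_convex⟩
  | succ k ih =>
    intro m hm
    obtain ⟨h1, -⟩ := ih (m + 1) (by omega)
    have hd : ∀ z : ℝ, 0 < z → HasDerivAt (fun z => (-1 : ℝ) ^ m * iteratedDeriv m ψ z)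
        ((-1 : ℝ) ^ m * iteratedDeriv (m + 1) ψ z) z := fun z hz =>
      (gen_hasDeriv hgen m (by omega) z hz).const_mul _
    have hc : ContinuousOn (fun z => (-1 : ℝ) ^ m * iteratedDeriv m ψ z) (Ioi 0) := fun z hz =>
      (hd z hz).continuousAt.continuousWithinAt
    have hdi : DifferentiableOn ℝ (fun z => (-1 : ℝ) ^ m * iteratedDeriv m ψ z)
        (interior (Ioi 0)) := fun z hz =>
      (hd z (interior_subset hz)).differentiableAt.differentiableWithinAt
    constructor
    · refine antitoneOn_of_deriv_nonpos (convex_Ioi 0) hc hdi ?_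
      intro z hz
      have hz' : 0 < z := interior_subset hz
      rw [(hd z hz').deriv]
      have := hgen.alt_sign (m + 1) (by omega) z hz'
      rw [pow_succ] at this
      linarith
    · refine MonotoneOn.convexOn_of_deriv (convex_Ioi 0) hc hdi ?_
      intro x hx y hy hxy
      have hx' : 0 < x := interior_subset hx
      have hy' : 0 < y := interior_subset hy
      rw [(hd x hx').deriv, (hd y hy').deriv]
      have := h1 hx' hy' hxy
      simp only [pow_succ] at this
      linarith

lemma gen_lip {d : ℕ} {ψ : ℝ → ℝ} {φ : ℝ → ℝ≥0∞} (hgen : IsGenerator d ψ φ) (m : ℕ)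
    (hm : m ≤ d - 2) (ε : ℝ) (hε : 0 < ε) :
    ∃ M : ℝ, DiffBd ε 1 M (iteratedDeriv m ψ) := by
  obtain ⟨h1, h2⟩ := gen_conv hgen (d - 2 - m) m (by omega)
  set g : ℝ → ℝ := fun z => (-1 : ℝ) ^ m * iteratedDeriv m ψ z with hg
  refine ⟨-((g ε - g (ε / 2)) / (ε - ε / 2)), ?_⟩
  intro h hh x hx
  have e : |iteratedDeriv m ψ x - iteratedDeriv m ψ (x + h)| = |g x - g (x + h)| := by
    rw [hg]
    simp only [← mul_sub, abs_mul, abs_pow, abs_neg, abs_one, one_pow, one_mul]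
  rw [e]
  have hx0 : 0 < x := hε.trans_le hx
  rcases hh.eq_or_lt with h0 | h0
  · simp [← h0]
  have a1 : g (x + h) ≤ g x := h1 hx0 (show (0:ℝ) < x + h by linarith) (by linarith)
  rw [abs_of_nonneg (by linarith)]
  have a2 := aux_slope h2 (x := ε / 2) (y := ε) (z := x) (w := x + h)
    (show (0:ℝ) < ε / 2 by linarith) (show (0:ℝ) < x + h by linarith) (by linarith) hx (by linarith)
  rw [le_div_iff₀ (by linarith)] at a2
  linarith

lemma gen_diffBd {d : ℕ} {ψ : ℝ → ℝ} {φ : ℝ → ℝ≥0∞} (hgen : IsGenerator d ψ φ) (m : ℕ)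
    (hm : m ≤ d - 2) (ε : ℝ) (hε : 0 < ε) : ∃ M : ℝ, DiffBd ε (m + 1) M ψ := by
  obtain ⟨M, hM⟩ := gen_lip hgen m hm ε hε
  have : ∀ k, k ≤ m → DiffBd ε (k + 1) M (iteratedDeriv (m - k) ψ) := by
    intro k
    induction k with
    | zero => intro _; simpa using hM
    | succ k ih =>
      intro hk
      refine DiffBd.of_deriv (k + 1) M _ _ (fun x hx => ?_) (ih (by omega))
      have := gen_hasDeriv hgen (m - (k + 1)) (by omega) x (hε.trans_le hx)
      rwa [show m - (k + 1) + 1 = m - k by omega] at this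
  exact ⟨M, by simpa using this m le_rfl⟩

lemma gen_psi_phi {d : ℕ} {ψ : ℝ → ℝ} {φ : ℝ → ℝ≥0∞} (hgen : IsGenerator d ψ φ) {t : ℝ}
    (h0 : 0 < t) (h1 : t ≤ 1) : ψ (φ t).toReal = t := by
  have := hgen.psi_phi t h0 h1
  rwa [evalPsi, if_neg (hgen.phi_finite t h0)] at this

lemma gen_phi_anti {d : ℕ} {ψ : ℝ → ℝ} {φ : ℝ → ℝ≥0∞} (hgen : IsGenerator d ψ φ) {s t : ℝ}
    (h0 : 0 < s) (hst : s ≤ t) (h1 : t ≤ 1) : (φ t).toReal ≤ (φ s).toReal :=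
  ENNReal.toReal_mono (hgen.phi_finite s h0)
    (hgen.phi_antitoneOn ⟨h0, hst.trans h1⟩ ⟨h0.trans_le hst, h1⟩ hst)

lemma gen_phi_santi {d : ℕ} {ψ : ℝ → ℝ} {φ : ℝ → ℝ≥0∞} (hgen : IsGenerator d ψ φ) {s t : ℝ}
    (h0 : 0 < s) (hst : s < t) (h1 : t ≤ 1) : (φ t).toReal < (φ s).toReal := by
  refine lt_of_le_of_ne (gen_phi_anti hgen h0 hst.le h1) ?_
  intro h
  have := gen_psi_phi hgen h0 (hst.le.trans h1)
  rw [← h, gen_psi_phi hgen (h0.trans hst) h1] at this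
  exact hst.ne' this

lemma gen_phi_pos {d : ℕ} {ψ : ℝ → ℝ} {φ : ℝ → ℝ≥0∞} (hgen : IsGenerator d ψ φ) {s : ℝ}
    (h0 : 0 < s) (h1 : s < 1) : 0 < (φ s).toReal :=
  lt_of_le_of_lt ENNReal.toReal_nonneg (gen_phi_santi hgen h0 h1 le_rfl)

lemma gen_phi_lip {d : ℕ} {ψ : ℝ → ℝ} {φ : ℝ → ℝ≥0∞} (hgen : IsGenerator d ψ φ) {δ : ℝ}
    (h0 : 0 < δ) : ∃ L : ℝ, 0 ≤ L ∧ ∀ a b, δ ≤ a → a ≤ b → b ≤ 1 - δ →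
      (φ a).toReal - (φ b).toReal ≤ L * (b - a) := by
  by_cases hδ : δ < 1
  swap
  · exact ⟨0, le_rfl, fun a b h1 h2 h3 => by linarith⟩
  have hc : ConvexOn ℝ (Ioi 0) ψ := by
    simpa using (gen_conv hgen (d - 2) 0 (by omega)).2
  set v := (φ δ).toReal
  set w := (φ (δ / 2)).toReal
  have hvw : v < w := gen_phi_santi hgen (by linarith) (by linarith) hδ.le
  have hv : ψ v = δ := gen_psi_phi hgen h0 hδ.le
  have hw : ψ w = δ / 2 := gen_psi_phi hgen (by linarith) (by linarith)
  refine ⟨(w - v) / (δ / 2), div_nonneg (by linarith) (by linarith), ?_⟩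
  intro a b ha hab hb
  rcases hab.eq_or_lt with h | h
  · simp [h]
  have hlt := gen_phi_santi hgen (h0.trans_le ha) h (by linarith)
  have hbp := gen_phi_pos hgen (s := b) (by linarith) (by linarith)
  have hav : (φ a).toReal ≤ v := gen_phi_anti hgen h0 ha (by linarith)
  have key := aux_slope hc (show (0:ℝ) < _ from hbp) (show (0:ℝ) < w by linarith) hlt hav hvw
  rw [gen_psi_phi hgen (by linarith : 0 < a) (by linarith),
    gen_psi_phi hgen (by linarith : 0 < b) (by linarith), hv, hw,
    div_le_div_iff₀ (by linarith) (by linarith)] at key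
  rw [div_mul_eq_mul_div, le_div_iff₀ (by linarith)]
  linarith
lemma ac_of_ball_bound {n : ℕ} (μ : Measure (Fin n → ℝ)) [IsFiniteMeasure μ]
    (h : ∀ᵐ x ∂μ, ∃ C : ℕ, ∀ᶠ r in 𝓝[>] (0 : ℝ),
      μ (Metric.closedBall x r) ≤ C * volume (Metric.closedBall x r)) :
    μ ≪ (volume : Measure (Fin n → ℝ)) := by
  intro N hN
  set S : ℕ → Set (Fin n → ℝ) := fun C => {x | x ∈ N ∧ ∀ᶠ r in 𝓝[>] (0 : ℝ),
      μ (Metric.closedBall x r) ≤ C * volume (Metric.closedBall x r)}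
  have hS : ∀ C, μ (S C) = 0 := by
    intro C
    have := (Besicovitch.vitaliFamily μ).measure_le_of_frequently_le (ρ := μ)
      ((C : NNReal) • (volume : Measure (Fin n → ℝ))) Measure.AbsolutelyContinuous.rfl (S C) ?_
    · refine le_antisymm (this.trans ?_) bot_le
      rw [Measure.smul_apply, measure_mono_null (fun x hx => hx.1) hN]
      simp
    · intro x hx
      refine (Besicovitch.tendsto_filterAt μ x).frequently ?_
      refine Eventually.frequently ?_
      filter_upwards [hx.2] with r hr
      simpa [Measure.smul_apply, ENNReal.smul_def] using hr
  have hsub : N ⊆ (⋃ C, S C) ∪ {x | ¬ ∃ C : ℕ, ∀ᶠ r in 𝓝[>] (0 : ℝ),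
      μ (Metric.closedBall x r) ≤ C * volume (Metric.closedBall x r)} := by
    intro x hx
    by_cases hc : ∃ C : ℕ, ∀ᶠ r in 𝓝[>] (0 : ℝ),
      μ (Metric.closedBall x r) ≤ C * volume (Metric.closedBall x r)
    · obtain ⟨C, hC⟩ := hc
      exact Or.inl (mem_iUnion.2 ⟨C, hx, hC⟩)
    · exact Or.inr hc
  exact measure_mono_null hsub (measure_union_null (measure_iUnion_null hS) h)

/-- Box that is half open in the directions of `s`. -/
def halfBox {n : ℕ} (a : Fin n → ℝ) (s : Finset (Fin n)) (c : Fin n → ℝ) : Set (Fin n → ℝ) :=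
  {t | ∀ i, (i ∈ s → a i < t i) ∧ t i ≤ c i}

lemma measurableSet_halfBox {n : ℕ} (a : Fin n → ℝ) (s : Finset (Fin n)) (c : Fin n → ℝ) :
    MeasurableSet (halfBox a s c) := by
  have : halfBox a s c = ⋂ i, ({t | i ∈ s → a i < t i} ∩ {t | t i ≤ c i}) := by
    ext t; simp [halfBox]
  rw [this]
  refine MeasurableSet.iInter fun i => MeasurableSet.inter ?_ ?_
  · by_cases hi : i ∈ s
    · simp only [hi, true_imp_iff]
      exact measurableSet_lt measurable_const (measurable_pi_apply i)
    · simp [hi]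
  · exact measurableSet_le (measurable_pi_apply i) measurable_const

lemma halfBox_bound {n : ℕ} {ψ f : ℝ → ℝ} (μ : Measure (Fin n → ℝ)) [IsFiniteMeasure μ]
    (hμ : ∀ c : Fin n → ℝ, (∀ i, c i ∈ Ioc (0 : ℝ) 1) →
      μ.real (lowerBox c) = ψ (∑ i, f (c i)))
    (a b : Fin n → ℝ) (ha : ∀ i, a i ∈ Ioc (0 : ℝ) 1) (hb : ∀ i, b i ∈ Ioc (0 : ℝ) 1)
    (hab : ∀ i, a i ≤ b i) (hf : ∀ i, f (b i) ≤ f (a i)) {ε M : ℝ} (hψ : DiffBd ε n M ψ)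
    (s : Finset (Fin n)) : ∀ m, m + s.card = n →
      ∃ G : ℝ → ℝ, DiffBd ε m (M * ∏ i ∈ s, (f (a i) - f (b i))) G ∧
        ∀ c : Fin n → ℝ, (∀ i, c i ∈ Ioc (0 : ℝ) 1) → (∀ i ∈ s, c i = b i) →
          μ.real (halfBox a s c) = G (∑ i, f (c i)) := by
  induction s using Finset.induction_on with
  | empty =>
    intro m hm
    simp only [Finset.card_empty, add_zero] at hm
    subst hm
    refine ⟨ψ, by simpa using hψ, fun c hc _ => ?_⟩
    rw [← hμ c hc]
    congr 1
    ext t; simp [halfBox, lowerBox]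
  | insert k s hk ih =>
    intro m hm
    rw [Finset.card_insert_of_notMem hk] at hm
    obtain ⟨G, hG, hGc⟩ := ih (m + 1) (by omega)
    refine ⟨fun x => G x - G (x + (f (a k) - f (b k))), ?_, ?_⟩
    · have := hG (f (a k) - f (b k)) (by linarith [hf k])
      rw [Finset.prod_insert hk]
      convert this using 1
      ring
    · intro c hc hcb
      have hck : c k = b k := hcb k (Finset.mem_insert_self _ _)
      have hcs : ∀ i ∈ s, c i = b i := fun i hi => hcb i (Finset.mem_insert_of_mem hi)
      set c' := Function.update c k (a k) with hc'
      have hne : ∀ i ∈ s, i ≠ k := fun i hi h => hk (h ▸ hi)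
      have e1 : halfBox a (insert k s) c = halfBox a s c \ halfBox a s c' := by
        ext t
        simp only [halfBox, Set.mem_sdiff, Set.mem_ofPred_eq, Finset.mem_insert]
        constructor
        · intro h
          refine ⟨fun i => ⟨fun hi => (h i).1 (Or.inr hi), (h i).2⟩, fun h' => ?_⟩
          have h1 := (h k).1 (Or.inl rfl)
          have h2 := (h' k).2
          simp [hc'] at h2
          linarith
        · rintro ⟨h1, h2⟩ i
          refine ⟨fun hi => ?_, (h1 i).2⟩
          rcases hi with rfl | hi
          · by_contra hcon
            apply h2
            intro j
            refine ⟨(h1 j).1, ?_⟩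
            by_cases hj : j = i
            · subst hj; simpa [hc'] using hcon
            · simpa [hc', hj] using (h1 j).2
          · exact (h1 i).1 hi
      have hsub : halfBox a s c' ⊆ halfBox a s c := by
        intro t ht i
        refine ⟨(ht i).1, (ht i).2.trans ?_⟩
        by_cases hi : i = k
        · subst hi; simpa [hc', hck] using hab i
        · simp [hc', hi]
      rw [e1, measureReal_sdiff hsub (measurableSet_halfBox _ _ _), hGc c hc hcs, hGc c' ?_ ?_]
      · congr 2
        rw [← Finset.add_sum_erase _ _ (Finset.mem_univ k),
          ← Finset.add_sum_erase _ (fun i => f (c i)) (Finset.mem_univ k)]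
        have : ∑ x ∈ Finset.univ.erase k, f (c' x) = ∑ x ∈ Finset.univ.erase k, f (c x) := by
          refine Finset.sum_congr rfl fun i hi => ?_
          simp [hc', Finset.ne_of_mem_erase hi]
        rw [this, hck]
        simp [hc']
        ring
      · intro i
        by_cases hi : i = k
        · subst hi; simpa [hc'] using ha i
        · simpa [hc', hi] using hc i
      · intro i hi
        rw [hc', Function.update_of_ne (hne i hi)]
        exact hcs i hi

lemma local_bound {d n : ℕ} (hn1 : 1 ≤ n) (hn : n ≤ d - 1) {ψ : ℝ → ℝ} {φ : ℝ → ℝ≥0∞}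
    (hgen : IsGenerator d ψ φ) (μ : Measure (Fin n → ℝ)) [IsFiniteMeasure μ]
    (hμ : ∀ c : Fin n → ℝ, (∀ i, c i ∈ Ioc (0 : ℝ) 1) →
      μ.real (lowerBox c) = ψ (∑ i, (φ (c i)).toReal))
    (x : Fin n → ℝ) (hx : ∀ i, x i ∈ Ioo (0 : ℝ) 1) :
    ∃ C : ℕ, ∀ᶠ r in 𝓝[>] (0 : ℝ),
      μ (Metric.closedBall x r) ≤ C * volume (Metric.closedBall x r) := by
  have hev : ∀ᶠ δ in 𝓝[>] (0 : ℝ), ∀ i, 2 * δ < x i ∧ x i < 1 - 2 * δ := by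
    rw [eventually_all]
    intro i
    have : ∀ᶠ δ in 𝓝 (0 : ℝ), 2 * δ < x i ∧ x i < 1 - 2 * δ := by
      refine Filter.Eventually.and ?_ ?_
      · exact (continuous_const.mul continuous_id).continuousAt.eventually_lt
          continuousAt_const (by simpa using (hx i).1)
      · exact continuousAt_const.eventually_lt
          (continuous_const.sub (continuous_const.mul continuous_id)).continuousAt
          (by simpa using (hx i).2)
    exact this.filter_mono nhdsWithin_le_nhds
  obtain ⟨δ, hδx, hδ⟩ := (hev.and self_mem_nhdsWithin).exists
  have hδ0 : 0 < δ := hδ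
  let i0 : Fin n := ⟨0, hn1⟩
  have hδ1 : δ < 1 := by have := hδx i0; linarith
  obtain ⟨M, hM⟩ := gen_diffBd hgen (n - 1) (by omega) (φ (1 - δ)).toReal
    (gen_phi_pos hgen (by linarith) (by linarith))
  rw [Nat.sub_add_cancel hn1] at hM
  obtain ⟨L, hL0, hL⟩ := gen_phi_lip hgen hδ0
  obtain ⟨C, hC⟩ := exists_nat_ge (|M| * (L * (3 / 2)) ^ n)
  refine ⟨C, ?_⟩
  have hr2 : ∀ᶠ r in 𝓝[>] (0 : ℝ), 2 * r < δ := by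
    have : ∀ᶠ r in 𝓝 (0 : ℝ), 2 * r < δ :=
      (continuous_const.mul continuous_id).continuousAt.eventually_lt
          continuousAt_const (by simpa using hδ0)
    exact this.filter_mono nhdsWithin_le_nhds
  filter_upwards [hr2, self_mem_nhdsWithin] with r hr hr0
  have hr0 : 0 < r := hr0
  set a : Fin n → ℝ := fun i => x i - 2 * r with ha
  set b : Fin n → ℝ := fun i => x i + r with hb
  have hδa : ∀ i, δ ≤ a i := fun i => by have := hδx i; simp only [ha]; linarith
  have hbδ : ∀ i, b i ≤ 1 - δ := fun i => by have := hδx i; simp only [hb]; linarith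
  have hab : ∀ i, a i ≤ b i := fun i => by simp only [ha, hb]; linarith
  obtain ⟨G, hG, hGc⟩ := halfBox_bound (f := fun t => (φ t).toReal) μ hμ a b
    (fun i => ⟨by linarith [hδa i], by linarith [hab i, hbδ i]⟩)
    (fun i => ⟨by linarith [hδa i, hab i], by linarith [hab i, hbδ i]⟩) hab
    (fun i => gen_phi_anti hgen (by linarith [hδa i]) (hab i) (by linarith [hbδ i]))
    hM Finset.univ 0 (by simp)
  have h1 := hGc b (fun i => ⟨by linarith [hδa i, hab i], by linarith [hab i, hbδ i]⟩)
    (fun _ _ => rfl)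
  have hsum : (φ (1 - δ)).toReal ≤ ∑ i, (φ (b i)).toReal :=
    (gen_phi_anti hgen (by linarith [hδa i0, hab i0]) (hbδ i0) (by linarith)).trans
      (Finset.single_le_sum (f := fun i => (φ (b i)).toReal)
        (fun i _ => ENNReal.toReal_nonneg) (Finset.mem_univ i0))
  have h2 := hG _ hsum
  rw [← h1] at h2
  have hsub : Metric.closedBall x r ⊆ halfBox a Finset.univ b := by
    intro t ht i
    have := (dist_le_pi_dist t x i).trans ht
    rw [Real.dist_eq, abs_le] at this
    simp only [ha, hb]
    exact ⟨fun _ => by linarith, by linarith⟩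
  have h3 : μ.real (Metric.closedBall x r) ≤ C * (2 * r) ^ n := by
    calc μ.real (Metric.closedBall x r) ≤ μ.real (halfBox a Finset.univ b) :=
          measureReal_mono hsub
      _ ≤ M * ∏ i, ((φ (a i)).toReal - (φ (b i)).toReal) := (le_abs_self _).trans h2
      _ ≤ |M| * ∏ i, ((φ (a i)).toReal - (φ (b i)).toReal) := by
          refine mul_le_mul_of_nonneg_right (le_abs_self M) (Finset.prod_nonneg fun i _ => ?_)
          have := gen_phi_anti hgen (by linarith [hδa i]) (hab i) (by linarith [hbδ i])
          linarith
      _ ≤ |M| * ∏ i : Fin n, (L * (3 * r)) := by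
          refine mul_le_mul_of_nonneg_left (Finset.prod_le_prod (fun i _ => ?_) fun i _ => ?_)
            (abs_nonneg M)
          · have := gen_phi_anti hgen (by linarith [hδa i]) (hab i) (by linarith [hbδ i])
            linarith
          · refine (hL (a i) (b i) (hδa i) (hab i) (hbδ i)).trans (le_of_eq ?_)
            simp only [ha, hb]; ring
      _ = (|M| * (L * (3 / 2)) ^ n) * (2 * r) ^ n := by
          rw [Finset.prod_const, Finset.card_univ, Fintype.card_fin, mul_assoc, ← mul_pow]
          congr 2; ring
      _ ≤ C * (2 * r) ^ n := mul_le_mul_of_nonneg_right hC (by positivity)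
  rw [Real.volume_pi_closedBall x hr0.le, Fintype.card_fin, ← ofReal_measureReal,
    ← ENNReal.ofReal_natCast C, ← ENNReal.ofReal_mul (by positivity)]
  exact ENNReal.ofReal_le_ofReal h3
lemma measurableSet_lowerBox {n : ℕ} (c : Fin n → ℝ) : MeasurableSet (lowerBox c) := by
  have : lowerBox c = ⋂ i, {t | t i ≤ c i} := by
    ext t; simp [lowerBox]
  rw [this]
  exact MeasurableSet.iInter fun i => measurableSet_le (measurable_pi_apply i) measurable_const

lemma cop_ae_one {d n : ℕ} {ψ : ℝ → ℝ} {φ : ℝ → ℝ≥0∞}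
    (hgen : IsGenerator d ψ φ) (μ : Measure (Fin n → ℝ)) [IsProbabilityMeasure μ]
    (hμ : ∀ x ∈ unitCube n, μ (lowerBox x) = ENNReal.ofReal (evalPsi ψ (∑ i, φ (x i)))) :
    ∀ᵐ t ∂μ, ∀ i, t i ≤ 1 := by
  have h := hμ (fun _ => 1) (fun i => ⟨by norm_num, le_rfl⟩)
  simp only [hgen.phi_one, Finset.sum_const_zero, evalPsi, ENNReal.zero_ne_top, if_false,
    ENNReal.toReal_zero, hgen.at_zero, ENNReal.ofReal_one] at h
  exact (mem_ae_iff_prob_eq_one (measurableSet_lowerBox _)).2 h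

lemma cop_marg {d n : ℕ} {ψ : ℝ → ℝ} {φ : ℝ → ℝ≥0∞}
    (hgen : IsGenerator d ψ φ) (μ : Measure (Fin n → ℝ)) [IsProbabilityMeasure μ]
    (hμ : ∀ x ∈ unitCube n, μ (lowerBox x) = ENNReal.ofReal (evalPsi ψ (∑ i, φ (x i))))
    (i : Fin n) (s : ℝ) (hs : s ∈ Ioc (0 : ℝ) 1) : μ {t | t i ≤ s} = ENNReal.ofReal s := by
  have h := hμ (Function.update (fun _ => 1) i s) (fun j => by
    by_cases hj : j = i
    · subst hj; simpa using ⟨hs.1.le, hs.2⟩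
    · simp [hj])
  have hsum : ∑ j, φ (Function.update (fun _ => (1 : ℝ)) i s j) = φ s := by
    rw [Finset.sum_eq_single i]
    · simp
    · intro j _ hj; simp [hj, hgen.phi_one]
    · simp
  rw [hsum, hgen.psi_phi s hs.1 hs.2] at h
  rw [← h]
  refine measure_congr ?_
  filter_upwards [cop_ae_one hgen μ hμ] with t ht
  apply propext
  change t i ≤ s ↔ ∀ j, t j ≤ _
  constructor
  · intro h j
    by_cases hj : j = i
    · subst hj; simpa using h
    · simpa [hj] using ht j
  · intro h
    simpa using h i

lemma cop_ae_Ioo {d n : ℕ} {ψ : ℝ → ℝ} {φ : ℝ → ℝ≥0∞}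
    (hgen : IsGenerator d ψ φ) (μ : Measure (Fin n → ℝ)) [IsProbabilityMeasure μ]
    (hμ : ∀ x ∈ unitCube n, μ (lowerBox x) = ENNReal.ofReal (evalPsi ψ (∑ i, φ (x i)))) :
    ∀ᵐ t ∂μ, ∀ i, t i ∈ Ioo (0 : ℝ) 1 := by
  rw [ae_all_iff]
  intro i
  have hle : ∀ (A : Set (Fin n → ℝ)),
      (∀ s : ℝ, 0 < s → s < 1 → μ A ≤ ENNReal.ofReal s) → μ A = 0 := by
    intro A hA
    have ht : Tendsto (fun s : ℝ => ENNReal.ofReal s) (𝓝[>] 0) (𝓝 0) := by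
      have := (ENNReal.continuous_ofReal.tendsto 0).mono_left
        (nhdsWithin_le_nhds (s := Ioi (0:ℝ)))
      simpa using this
    refine le_antisymm (ge_of_tendsto ht ?_) bot_le
    filter_upwards [Ioo_mem_nhdsGT (show (0:ℝ) < 1 by norm_num)] with s hs
    exact hA s hs.1 hs.2
  have h0 : μ {t | t i ≤ 0} = 0 := by
    refine hle _ fun s hs hs1 => ?_
    rw [← cop_marg hgen μ hμ i s ⟨hs, hs1.le⟩]
    exact measure_mono fun t (ht : t i ≤ 0) => (show t i ≤ s by linarith)
  have h1 : μ {t | 1 ≤ t i} = 0 := by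
    refine hle _ fun s hs hs1 => ?_
    have hm : MeasurableSet {t : Fin n → ℝ | t i ≤ 1 - s} :=
      measurableSet_le (measurable_pi_apply i) measurable_const
    calc μ {t | 1 ≤ t i} ≤ μ {t | t i ≤ 1 - s}ᶜ :=
          measure_mono fun t (ht : 1 ≤ t i) (h : t i ≤ 1 - s) => by linarith
      _ = ENNReal.ofReal s := by
          rw [prob_compl_eq_one_sub hm, cop_marg hgen μ hμ i (1 - s) ⟨by linarith, by linarith⟩,
            ← ENNReal.ofReal_one, ← ENNReal.ofReal_sub _ (by linarith)]
          congr 1; ring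
  have h0' : ∀ᵐ t ∂μ, ¬ (t i ≤ 0) := by rw [ae_iff]; simpa using h0
  have h1' : ∀ᵐ t ∂μ, ¬ (1 ≤ t i) := by rw [ae_iff]; simpa using h1
  filter_upwards [h0', h1'] with t a b
  exact ⟨not_le.1 a, not_le.1 b⟩

lemma cop_unique {d n : ℕ} {ψ : ℝ → ℝ} {φ : ℝ → ℝ≥0∞}
    (hgen : IsGenerator d ψ φ) (μ ν : Measure (Fin n → ℝ)) [IsProbabilityMeasure μ]
    [IsProbabilityMeasure ν]
    (hμ : ∀ x ∈ unitCube n, μ (lowerBox x) = ENNReal.ofReal (evalPsi ψ (∑ i, φ (x i))))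
    (hν : ∀ x ∈ unitCube n, ν (lowerBox x) = ENNReal.ofReal (evalPsi ψ (∑ i, φ (x i)))) :
    μ = ν := by
  have key : ∀ (ρ : Measure (Fin n → ℝ)) [IsProbabilityMeasure ρ],
      (∀ x ∈ unitCube n, ρ (lowerBox x) = ENNReal.ofReal (evalPsi ψ (∑ i, φ (x i)))) →
      ∀ x, ρ (lowerBox x) = if ∀ i, 0 < x i then
        ENNReal.ofReal (evalPsi ψ (∑ i, φ (min (x i) 1))) else 0 := by
    intro ρ _ hρ x
    have hae := cop_ae_Ioo hgen ρ hρ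
    split_ifs with h
    · rw [← hρ (fun i => min (x i) 1) (fun i => ⟨le_min (h i).le zero_le_one, min_le_right _ _⟩)]
      refine measure_congr ?_
      filter_upwards [hae] with t ht
      apply propext
      change (∀ i, t i ≤ x i) ↔ ∀ i, t i ≤ min (x i) 1
      exact forall_congr' fun i => by
        rw [le_min_iff]; exact ⟨fun h => ⟨h, (ht i).2.le⟩, fun h => h.1⟩
    · push Not at h
      obtain ⟨i, hi⟩ := h
      refine measure_mono_null (t := {t | ¬ ∀ i, t i ∈ Ioo (0:ℝ) 1}) ?_ hae
      intro t ht hc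
      have := ht i
      have := (hc i).1
      linarith
  have hgenr : (MeasurableSpace.pi : MeasurableSpace (Fin n → ℝ)) =
      MeasurableSpace.generateFrom (Set.pi univ '' Set.pi univ fun _ : Fin n => range (Iic : ℝ → Set ℝ)) := by
    refine (generateFrom_eq_pi (fun i => ?_) (fun i => ?_)).symm
    · rw [← borel_eq_generateFrom_Iic]; exact (BorelSpace.measurable_eq).symm
    · refine ⟨fun k : ℕ => Iic (k : ℝ), fun k => ⟨k, rfl⟩, ?_⟩
      refine eq_univ_of_forall fun x => mem_iUnion.2 ?_
      exact exists_nat_ge x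
  refine ext_of_generate_finite _ hgenr (IsPiSystem.pi fun _ => isPiSystem_Iic) ?_ (by simp)
  rintro _ ⟨S, hS, rfl⟩
  have hS' : ∀ i, ∃ x : ℝ, Iic x = S i := fun i => hS i (mem_univ i)
  choose x hx using hS'
  have e : Set.pi univ S = lowerBox x := by
    ext t
    simp [lowerBox, ← hx]
  rw [e, key μ hμ, key ν hν]

lemma cop_ac {d n : ℕ} (hn1 : 1 ≤ n) (hn : n ≤ d - 1) {ψ : ℝ → ℝ} {φ : ℝ → ℝ≥0∞}
    (hgen : IsGenerator d ψ φ) (μ : Measure (Fin n → ℝ)) [IsProbabilityMeasure μ]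
    (hμ : ∀ x ∈ unitCube n, μ (lowerBox x) = ENNReal.ofReal (evalPsi ψ (∑ i, φ (x i)))) :
    μ ≪ (volume : Measure (Fin n → ℝ)) := by
  refine ac_of_ball_bound μ ?_
  filter_upwards [cop_ae_Ioo hgen μ hμ] with x hx
  refine local_bound hn1 hn hgen μ (fun c hc => ?_) x hx
  have hfin : ∀ i ∈ Finset.univ, φ (c i) ≠ ∞ := fun i _ => hgen.phi_finite _ (hc i).1
  rw [measureReal_def, hμ c (fun i => ⟨(hc i).1.le, (hc i).2⟩), evalPsi,
    if_neg (ENNReal.sum_ne_top.2 hfin), ENNReal.toReal_sum hfin, ENNReal.toReal_ofReal]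
  exact hgen.nonneg _ (Finset.sum_nonneg fun _ _ => ENNReal.toReal_nonneg)

lemma disint_fwd {α β : Type*} [MeasurableSpace α] [MeasurableSpace β]
    (μ : Measure (α × β)) (K : Kernel α β) [IsMarkovKernel K] (hK : IsDisintegration μ K)
    (ν₁ : Measure α) (ν₂ : Measure β) [SigmaFinite ν₁] [SigmaFinite ν₂]
    (hac : μ.map Prod.fst ≪ ν₁) (hs : μ ⟂ₘ ν₁.prod ν₂) :
    ∀ᵐ a ∂(μ.map Prod.fst), K a ⟂ₘ ν₂ := by
  obtain ⟨N, hN, h1, h2⟩ := hs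
  rw [hK N hN, lintegral_eq_zero_iff (Kernel.measurable_kernel_prodMk_left hN)] at h1
  have h3 := hac.ae_le (Measure.ae_ae_of_ae_prod (measure_eq_zero_iff_ae_notMem.1 h2))
  filter_upwards [h1, h3] with a ha hb
  refine ⟨Prod.mk a ⁻¹' N, measurable_prodMk_left hN, ha, ?_⟩
  rw [measure_eq_zero_iff_ae_notMem]
  exact hb

lemma disint_bwd {α β : Type*} [MeasurableSpace α] [MeasurableSpace β]
    [MeasurableSpace.CountableOrCountablyGenerated α β]
    (μ : Measure (α × β)) (K : Kernel α β) [IsMarkovKernel K] (hK : IsDisintegration μ K)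
    (ν₁ : Measure α) (ν₂ : Measure β) [SigmaFinite ν₁] [SigmaFinite ν₂]
    (hs : ∀ᵐ a ∂(μ.map Prod.fst), K a ⟂ₘ ν₂) : μ ⟂ₘ ν₁.prod ν₂ := by
  set η : Kernel α β := Kernel.const α ν₂.toFinite with hη
  have hS := Kernel.measurableSet_mutuallySingularSet K η
  refine ⟨(Kernel.mutuallySingularSet K η)ᶜ, hS.compl, ?_, ?_⟩
  · rw [hK _ hS.compl, lintegral_eq_zero_iff (Kernel.measurable_kernel_prodMk_left hS.compl)]
    filter_upwards [hs] with a ha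
    have h1 : K a ⟂ₘ η a := by
      rw [hη, Kernel.const_apply]
      exact ha.mono_ac Measure.AbsolutelyContinuous.rfl (toFinite_absolutelyContinuous ν₂)
    exact (Kernel.withDensity_rnDeriv_eq_zero_iff_measure_eq_zero K η a).1
      ((Kernel.withDensity_rnDeriv_eq_zero_iff_mutuallySingular K η a).2 h1)
  · rw [compl_compl, Measure.prod_apply hS]
    refine (lintegral_eq_zero_iff (measurable_measure_prodMk_left hS)).2 (ae_of_all _ fun a => ?_)
    exact absolutelyContinuous_toFinite ν₂ (Kernel.measure_mutuallySingularSetSlice K η a)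

/-- Index splitting. -/
def idxE {d l : ℕ} (h : l ≤ d) : Fin l ⊕ Fin (d - l) ≃ Fin d :=
  finSumFinEquiv.trans (finCongr (by omega))

/-- Splitting of coordinates. -/
def splitE {d l : ℕ} (h : l ≤ d) : (Fin d → ℝ) ≃ᵐ (Fin l → ℝ) × (Fin (d - l) → ℝ) :=
  (MeasurableEquiv.piCongrLeft (fun _ => ℝ) (idxE h)).symm.trans
    (MeasurableEquiv.sumPiEquivProdPi (fun _ => ℝ))

lemma splitE_apply {d l : ℕ} (h : l ≤ d) (t : Fin d → ℝ) :
    splitE h t = (fun i => t (idxE h (Sum.inl i)), fun j => t (idxE h (Sum.inr j))) := rfl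

lemma splitE_mp {d l : ℕ} (h : l ≤ d) :
    MeasurePreserving (splitE h) (volume : Measure (Fin d → ℝ))
      ((volume : Measure (Fin l → ℝ)).prod (volume : Measure (Fin (d - l) → ℝ))) :=
  (volume_measurePreserving_sumPiEquivProdPi (fun _ : Fin l ⊕ Fin (d - l) => ℝ)).comp
    ((volume_measurePreserving_piCongrLeft (fun _ : Fin d => ℝ) (idxE h)).symm _)

lemma splitE_preimage {d l : ℕ} (h : l ≤ d) (x : Fin l → ℝ) (y : Fin (d - l) → ℝ) :
    splitE h ⁻¹' (lowerBox x ×ˢ lowerBox y) = lowerBox ((splitE h).symm (x, y)) := by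
  obtain ⟨t, ht⟩ := (splitE h).surjective (x, y)
  rw [← ht, MeasurableEquiv.symm_apply_apply]
  rw [splitE_apply] at ht
  obtain ⟨rfl, rfl⟩ := Prod.mk.inj ht
  ext s
  simp only [mem_preimage, splitE_apply, mem_prod, lowerBox]
  change ((∀ _, _) ∧ ∀ _, _) ↔ ∀ i, s i ≤ t i
  rw [← (idxE h).forall_congr_right (q := fun i => s i ≤ t i), Sum.forall]

lemma splitE_sum {d l : ℕ} (h : l ≤ d) (φ : ℝ → ℝ≥0∞) (t : Fin d → ℝ) :
    ∑ i, φ (t i) = (∑ i, φ ((splitE h t).1 i)) + ∑ j, φ ((splitE h t).2 j) := by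
  rw [← (idxE h).sum_comp, Fintype.sum_sum_type]
  rfl

lemma splitE_cube {d l : ℕ} (h : l ≤ d) (t : Fin d → ℝ) :
    t ∈ unitCube d ↔ (splitE h t).1 ∈ unitCube l ∧ (splitE h t).2 ∈ unitCube (d - l) := by
  change (∀ i, t i ∈ Icc (0:ℝ) 1) ↔ (∀ _, _) ∧ ∀ _, _
  rw [← (idxE h).forall_congr_right (q := fun i => t i ∈ Icc (0:ℝ) 1), Sum.forall]
  rfl

lemma split_sing {d l : ℕ} (h : l ≤ d) (μ : Measure (Fin d → ℝ)) :
    μ ⟂ₘ volume ↔ μ.map (splitE h) ⟂ₘ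
      (volume : Measure (Fin l → ℝ)).prod (volume : Measure (Fin (d - l) → ℝ)) := by
  rw [← (splitE_mp h).map_eq]
  constructor
  · rintro ⟨N, hN, h1, h2⟩
    refine ⟨(splitE h).symm ⁻¹' N, (splitE h).symm.measurable hN, ?_, ?_⟩
    · rw [MeasurableEquiv.map_apply, ← preimage_comp]; simpa using h1
    · rw [MeasurableEquiv.map_apply, preimage_compl, ← preimage_comp]; simpa using h2
  · rintro ⟨N, hN, h1, h2⟩
    rw [MeasurableEquiv.map_apply] at h1 h2
    exact ⟨_, (splitE h).measurable hN, h1, h2⟩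

/-- **Corollary 5.2.** A `d`-dimensional Archimedean copula `C` (with generator `ψ`,
its measure `μ` on `ℝ^d` being characterized by `μ([0,x]) = ψ(Σᵢφ(xᵢ))`) is singular
w.r.t. `λ_d` if and only if, for every `ℓ ∈ {1,…,d-1}`, almost all of its uni- and
multivariate conditional distributions (i.e. `ℓ`-Markov kernels) are singular w.r.t.
the appropriate Lebesgue measure `λ_{d-ℓ}`. -/
theorem arch_singular_iff_all_kernels_singular
    (d : ℕ) (hd : 2 ≤ d)
    (ψ : ℝ → ℝ) (φ : ℝ → ℝ≥0∞) (hgen : IsGenerator d ψ φ)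
    (μ : Measure (Fin d → ℝ)) (hμp : IsProbabilityMeasure μ)
    (hμ : ∀ x ∈ unitCube d, μ (lowerBox x) = ENNReal.ofReal (evalPsi ψ (∑ i, φ (x i)))) :
    μ ⟂ₘ (volume : Measure (Fin d → ℝ)) ↔
      ∀ l : ℕ, 1 ≤ l → l ≤ d - 1 →
        ∀ μp : Measure ((Fin l → ℝ) × (Fin (d - l) → ℝ)), IsProbabilityMeasure μp →
          (∀ x ∈ unitCube l, ∀ y ∈ unitCube (d - l),
            μp (lowerBox x ×ˢ lowerBox y)
              = ENNReal.ofReal (evalPsi ψ ((∑ i, φ (x i)) + ∑ j, φ (y j)))) →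
          ∀ K : Kernel (Fin l → ℝ) (Fin (d - l) → ℝ), IsMarkovKernel K →
            IsDisintegration μp K →
            ∃ Λ : Set (Fin l → ℝ), MeasurableSet Λ ∧ μp.map Prod.fst Λ = 1 ∧
              ∀ x ∈ Λ, (K x) ⟂ₘ (volume : Measure (Fin (d - l) → ℝ)) := by
  constructor
  · intro hsing l hl1 hl μp hμpp hcdf K hK hdis
    have hld : l ≤ d := by omega
    have hpe : IsProbabilityMeasure (μp.map (splitE hld).symm) :=
      Measure.isProbabilityMeasure_map (splitE hld).symm.measurable.aemeasurable
    have hEq : μp.map (splitE hld).symm = μ := by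
      refine cop_unique hgen _ _ (fun t ht => ?_) hμ
      have ht' := (splitE_cube hld t).1 ht
      have e : lowerBox t = splitE hld ⁻¹' (lowerBox (splitE hld t).1 ×ˢ lowerBox (splitE hld t).2) := by
        rw [splitE_preimage]; simp
      rw [MeasurableEquiv.map_apply, e, ← preimage_comp, splitE_sum hld φ t,
        ← hcdf _ ht'.1 _ ht'.2]
      simp
    have hEq2 : μ.map (splitE hld) = μp := by
      rw [← hEq, Measure.map_map (splitE hld).measurable (splitE hld).symm.measurable]
      simp
    rw [split_sing hld, hEq2] at hsing
    have hp1 : IsProbabilityMeasure (μp.map Prod.fst) :=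
      Measure.isProbabilityMeasure_map measurable_fst.aemeasurable
    have hone : ∀ k, (fun _ : Fin k => (1 : ℝ)) ∈ unitCube k := fun k i =>
      ⟨zero_le_one, le_rfl⟩
    have hae : ∀ᵐ p ∂μp, p ∈ lowerBox (fun _ : Fin l => (1 : ℝ)) ×ˢ
        lowerBox (fun _ : Fin (d - l) => (1 : ℝ)) := by
      refine (mem_ae_iff_prob_eq_one
        ((measurableSet_lowerBox _).prod (measurableSet_lowerBox _))).2 ?_
      rw [hcdf _ (hone _) _ (hone _)]
      simp [hgen.phi_one, evalPsi, hgen.at_zero]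
    have hac : μp.map Prod.fst ≪ (volume : Measure (Fin l → ℝ)) := by
      refine cop_ac hl1 hl hgen _ fun x hx => ?_
      rw [Measure.map_apply measurable_fst (measurableSet_lowerBox _)]
      have h2 := hcdf x hx _ (hone _)
      simp only [hgen.phi_one, Finset.sum_const_zero, add_zero] at h2
      rw [← h2]
      refine measure_congr ?_
      filter_upwards [hae] with p hp
      apply propext
      exact ⟨fun h => ⟨h, hp.2⟩, fun h => h.1⟩
    have hfin := disint_fwd μp K hdis volume volume hac hsing
    obtain ⟨Λ, hsub, hm, hΛ⟩ := exists_measurable_superset_of_null (ae_iff.1 hfin)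
    refine ⟨Λᶜ, hm.compl, ?_, fun x hx => ?_⟩
    · rw [prob_compl_eq_one_sub hm, hΛ, tsub_zero]
    · by_contra hcon
      exact hx (hsub hcon)
  · intro hall
    have hld : 1 ≤ d := by omega
    have hpe : IsProbabilityMeasure (μ.map (splitE hld)) :=
      Measure.isProbabilityMeasure_map (splitE hld).measurable.aemeasurable
    have hdis : IsDisintegration (μ.map (splitE hld)) (μ.map (splitE hld)).condKernel := by
      intro G hG
      conv_lhs => rw [← (μ.map (splitE hld)).disintegrate (μ.map (splitE hld)).condKernel]
      rw [Measure.compProd_apply hG]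
      rfl
    obtain ⟨Λ, hm, hΛ, hs⟩ := hall 1 le_rfl (by omega) (μ.map (splitE hld)) hpe
      (fun x hx y hy => by
        rw [MeasurableEquiv.map_apply, splitE_preimage, hμ, splitE_sum hld]
        · simp
        · rw [splitE_cube hld]; simpa using ⟨hx, hy⟩) _ inferInstance hdis
    rw [split_sing hld]
    refine disint_bwd _ _ hdis volume volume ?_
    have hp1 : IsProbabilityMeasure ((μ.map (splitE hld)).map Prod.fst) :=
      Measure.isProbabilityMeasure_map measurable_fst.aemeasurable
    filter_upwards [(mem_ae_iff_prob_eq_one hm).2 hΛ] with x hx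
    exact hs x hx
end
end
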